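/- arXiv:1804.05220 — 3 statements merged into one kernel-verified Lean document; each statement's English description precedes it below -/
import Mathlib

section
/- Let g ∈ C_c^∞(ℝ^d) with support in (-1,1)^d and ∑_{γ∈ℤ^d} g(x-γ)^2 = 1, and let φ : ℝ^d × ℝ^d → ℝ be smooth in the first variable with ∂_x φ(x,γ) of at most linear growth in |x-γ|, uniformly in γ. Define G^φ_{γ,m}(x) := (2π)^{-d/2} e^{iφ(x,γ)} g(x-γ) e^{im·(x-γ)} for γ, m ∈ ℤ^d. Then for every Schwartz function f, f(x) = ∑_{γ,m ∈ ℤ^d} G^φ_{γ,m}(x) ⟨G^φ_{γ,m}, f⟩_{L²}, with the double series absolutely convergent. -/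
noncomputable section
open MeasureTheory Real Complex

/-- Coercion of a lattice point in `ℤ^d` to `ℝ^d`. -/
def zc {d : ℕ} (γ : Fin d → ℤ) : Fin d → ℝ := fun i => (γ i : ℝ)

/-- Euclidean dot product on `ℝ^d`. -/
def dotR {d : ℕ} (a b : Fin d → ℝ) : ℝ := ∑ i, a i * b i

/-- The magnetic Gabor frame element
`G^φ_{γ,m}(x) = (2π)^{-d/2} e^{iφ(x,γ)} g(x-γ) e^{im·(x-γ)}`. -/
def Gab {d : ℕ} (φ : (Fin d → ℝ) → (Fin d → ℝ) → ℝ) (g : (Fin d → ℝ) → ℝ)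
    (γ m : Fin d → ℤ) (x : Fin d → ℝ) : ℂ :=
  ((2 * π : ℝ) ^ (-(d : ℝ) / 2) : ℝ) * Complex.exp (Complex.I * (φ x (zc γ) : ℝ)) *
    (g (x - zc γ) : ℝ) * Complex.exp (Complex.I * (dotR (zc m) (x - zc γ) : ℝ))

/-- The magnetic Gabor coefficient `⟨G^φ_{γ,m}, f⟩_{L²}` (conjugate-linear in the
first argument). -/
def coefG {d : ℕ} (φ : (Fin d → ℝ) → (Fin d → ℝ) → ℝ) (g : (Fin d → ℝ) → ℝ)
    (γ m : Fin d → ℤ) (f : (Fin d → ℝ) → ℂ) : ℂ :=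
  ∫ y, (starRingEnd ℂ) (Gab φ g γ m y) * f y

/-- The function on the torus whose restriction to the fundamental domain `(-1/2, 1/2]^d`
is `h`. -/
def torusLift {d : ℕ} (h : (Fin d → ℝ) → ℂ) (t : UnitAddTorus (Fin d)) : ℂ :=
  h fun i => (AddCircle.equivIoc 1 (-1 / 2 : ℝ) (t i)).1

lemma torusLift_coe {d : ℕ} (h : (Fin d → ℝ) → ℂ) {x : Fin d → ℝ}
    (hx : ∀ i, x i ∈ Set.Ioc (-1 / 2 : ℝ) (-1 / 2 + 1)) :
    torusLift h (fun i => (x i : UnitAddCircle)) = h x := by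
  unfold torusLift
  congr 1
  funext i
  exact congrArg Subtype.val (AddCircle.equivIoc_coe_eq (hx i))

lemma continuous_torusLift {d : ℕ} {h : (Fin d → ℝ) → ℂ} (hc : Continuous h) {a : ℝ}
    (ha : a < 1 / 2) (hs : ∀ x, h x ≠ 0 → ∀ i, |x i| ≤ a) : Continuous (torusLift h) := by
  rw [continuous_iff_continuousAt]
  intro t
  by_cases ht : ∃ i, t i = ((-1 / 2 : ℝ) : UnitAddCircle)
  · obtain ⟨i, hi⟩ := ht
    have hn : a < ‖t i‖ := by
      rw [hi, UnitAddCircle.norm_eq]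
      have h1 : round (-1 / 2 : ℝ) = 0 := by
        rw [round_eq]; norm_num
      rw [h1]; norm_num [abs_div]; linarith
    have hev : ∀ᶠ s : UnitAddTorus (Fin d) in nhds t, a < ‖s i‖ :=
      ((continuous_apply i).norm.continuousAt (x := t)).eventually (lt_mem_nhds hn)
    have h0 : ∀ s : UnitAddTorus (Fin d), a < ‖s i‖ → torusLift h s = 0 := by
      intro s hsi
      by_contra hne
      have h2 := hs _ hne i
      have h3 : ((AddCircle.equivIoc 1 (-1 / 2 : ℝ) (s i)).1 : UnitAddCircle) = s i :=
        (AddCircle.equivIoc 1 (-1 / 2 : ℝ)).symm_apply_apply (s i)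
      have h4 : ‖s i‖ ≤ |(AddCircle.equivIoc 1 (-1 / 2 : ℝ) (s i)).1| := by
        conv_lhs => rw [← h3]
        exact QuotientAddGroup.norm_mk_le_norm
      linarith
    exact (continuousAt_const (y := (0 : ℂ))).congr
      (hev.mono fun s hsi => (h0 s hsi).symm)
  · push Not at ht
    refine hc.continuousAt.comp (continuousAt_pi.2 fun i => ?_)
    exact continuousAt_subtype_val.comp
      ((AddCircle.continuousAt_equivIoc 1 (-1 / 2 : ℝ) (ht i)).comp
        (f := fun s : UnitAddTorus (Fin d) => s i) (continuous_apply i).continuousAt)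

lemma mFourier_coe {d : ℕ} (n : Fin d → ℤ) (x : Fin d → ℝ) :
    UnitAddTorus.mFourier n (fun i => (x i : UnitAddCircle)) =
      Complex.exp (Complex.I * ((2 * π * dotR (zc n) x : ℝ) : ℂ)) := by
  simp only [UnitAddTorus.mFourier, ContinuousMap.coe_mk, fourier_coe_apply, dotR, zc]
  rw [← Complex.exp_sum]
  congr 1
  push_cast
  simp only [Finset.mul_sum]
  refine Finset.sum_congr rfl fun i _ => ?_
  ring

lemma mFourierCoeff_torusLift {d : ℕ} {h : (Fin d → ℝ) → ℂ} {a : ℝ}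
    (ha : a < 1 / 2) (hs : ∀ x, h x ≠ 0 → ∀ i, |x i| ≤ a) (n : Fin d → ℤ) :
    UnitAddTorus.mFourierCoeff (torusLift h) n =
      ∫ x, Complex.exp (-(Complex.I * ((2 * π * dotR (zc n) x : ℝ) : ℂ))) * h x := by
  rw [UnitAddTorus.mFourierCoeff_eq_integral _ _ fun _ => (-1 / 2 : ℝ)]
  have hm : MeasurableSet {x : Fin d → ℝ | ∀ i, x i ∈ Set.Ioc (-1 / 2 : ℝ) (-1 / 2 + 1)} :=
    MeasurableSet.univ_pi' fun _ => measurableSet_Ioc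
  trans ∫ x in {x : Fin d → ℝ | ∀ i, x i ∈ Set.Ioc (-1 / 2 : ℝ) (-1 / 2 + 1)},
    Complex.exp (-(Complex.I * ((2 * π * dotR (zc n) x : ℝ) : ℂ))) * h x
  · refine setIntegral_congr_fun hm fun x hx => ?_
    simp only [smul_eq_mul]
    rw [torusLift_coe h hx, mFourier_coe]
    congr 2
    simp [dotR, zc, Finset.sum_neg_distrib]
  · refine setIntegral_eq_integral_of_forall_compl_eq_zero fun x hx => ?_
    by_contra hne
    refine hx fun i => ?_
    have := abs_le.1 (hs x (right_ne_zero_of_mul hne) i)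
    constructor <;> linarith

lemma summable_norm_zc_inv_pow (d : ℕ) :
    Summable fun n : Fin d → ℤ => ‖zc n‖⁻¹ ^ (d + 1) := by
  let b := Pi.basisFun ℝ (Fin d)
  let L : Submodule ℤ (Fin d → ℝ) := Submodule.span ℤ (Set.range b)
  have hL : Module.finrank ℤ L < d + 1 := by
    rw [ZLattice.rank ℝ L]; simp
  have hmem : ∀ n : Fin d → ℤ, zc n ∈ L := by
    intro n
    have : zc n = ∑ i, n i • b i := by
      funext j
      simp [zc, b, Finset.sum_apply, Pi.single_apply]
    rw [this]
    exact Submodule.sum_mem _ fun i _ => Submodule.smul_mem _ _ (Submodule.subset_span ⟨i, rfl⟩)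
  have hinj : Function.Injective fun n : Fin d → ℤ => (⟨zc n, hmem n⟩ : L) := by
    intro m n hmn
    funext i
    have := congrFun (congrArg Subtype.val hmn) i
    simpa [zc] using this
  have := (ZLattice.summable_norm_pow_inv L (d + 1) hL).comp_injective hinj
  exact this

open scoped FourierTransform in
lemma summable_norm_integral_exp_mul {d : ℕ} {h : (Fin d → ℝ) → ℂ}
    (hh : ContDiff ℝ (⊤ : ℕ∞) h) (hc : HasCompactSupport h) :
    Summable fun n : Fin d → ℤ =>
      ‖∫ x, Complex.exp (-(Complex.I * ((2 * π * dotR (zc n) x : ℝ) : ℂ))) * h x‖ := by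
  let e : EuclideanSpace ℝ (Fin d) ≃L[ℝ] (Fin d → ℝ) := EuclideanSpace.equiv (Fin d) ℝ
  have hc' : HasCompactSupport (h ∘ e) := hc.comp_homeomorph e.toHomeomorph
  have hh' : ContDiff ℝ (⊤ : ℕ∞) (h ∘ e) := hh.comp e.contDiff
  let F : SchwartzMap (EuclideanSpace ℝ (Fin d)) ℂ := hc'.toSchwartzMap hh'
  obtain ⟨C, hC0, hC⟩ := (𝓕 F).decay (d + 1) 0
  have hF : ∀ n : Fin d → ℤ,
      ∫ x, Complex.exp (-(Complex.I * ((2 * π * dotR (zc n) x : ℝ) : ℂ))) * h x =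
        (𝓕 F) (WithLp.toLp 2 (zc n)) := by
    intro n
    rw [SchwartzMap.fourier_coe, Real.fourier_eq',
      ← (EuclideanSpace.volume_preserving_symm_measurableEquiv_toLp (Fin d)).integral_comp
        (MeasurableEquiv.measurableEmbedding _)]
    refine integral_congr_ae (Filter.Eventually.of_forall fun x => ?_)
    simp only [smul_eq_mul]
    congr 2
    simp [dotR, PiLp.inner_apply, mul_comm]
  have hle : ∀ n : Fin d → ℤ, ‖zc n‖ ≤ ‖WithLp.toLp 2 (zc n)‖ := by
    intro n
    refine (pi_norm_le_iff_of_nonneg (norm_nonneg _)).2 fun i => ?_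
    exact PiLp.norm_apply_le (WithLp.toLp 2 (zc n)) i
  refine Summable.of_norm_bounded_eventually
    ((summable_norm_zc_inv_pow d).mul_left C) ?_
  refine (Set.finite_singleton (0 : Fin d → ℤ)).subset ?_
  intro n hn
  by_contra hn0
  refine hn ?_
  have hz : 0 < ‖zc n‖ := by
    rw [norm_pos_iff]
    intro h0
    apply hn0
    funext i
    simpa [zc] using congrFun h0 i
  rw [Set.mem_ofPred_eq, hF, norm_norm, inv_pow, ← div_eq_mul_inv, le_div_iff₀ (by positivity)]
  have h1 := hC (WithLp.toLp 2 (zc n))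
  rw [norm_iteratedFDeriv_zero] at h1
  rw [mul_comm]
  refine le_trans ?_ h1
  gcongr
  exact hle n

/-- Pointwise Fourier inversion for a smooth function supported in `[-1, 1]^d`, expanded into
`2π`-periodic exponentials. -/
lemma hasSum_fourier_of_support_box {d : ℕ} {k : (Fin d → ℝ) → ℂ}
    (hk : ContDiff ℝ (⊤ : ℕ∞) k) (hs : ∀ x, k x ≠ 0 → ∀ i, |x i| ≤ 1)
    {x : Fin d → ℝ} (hx : ∀ i, |x i| ≤ 1) :
    Summable (fun n : Fin d → ℤ =>
      ‖∫ y, Complex.exp (-(Complex.I * (dotR (zc n) y : ℝ))) * k y‖) ∧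
    HasSum (fun n : Fin d → ℤ =>
      (∫ y, Complex.exp (-(Complex.I * (dotR (zc n) y : ℝ))) * k y) *
        Complex.exp (Complex.I * (dotR (zc n) x : ℝ))) ((2 * π : ℂ) ^ d * k x) := by
  have hpi : (0 : ℝ) < 2 * π := by positivity
  have ha : (2 * π)⁻¹ < (1 / 2 : ℝ) := by
    rw [one_div]
    exact inv_strictAnti₀ (by norm_num) (by linarith [Real.pi_gt_three])
  let h : (Fin d → ℝ) → ℂ := fun z => k ((2 * π) • z)
  have hh : ContDiff ℝ (⊤ : ℕ∞) h := hk.comp (contDiff_const_smul (2 * π))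
  have hbox : ∀ z : Fin d → ℝ, h z ≠ 0 → ∀ i, |z i| ≤ (2 * π)⁻¹ := by
    intro z hz i
    have := hs _ hz i
    rw [Pi.smul_apply, smul_eq_mul, abs_mul, abs_of_pos hpi] at this
    rwa [inv_eq_one_div, le_div_iff₀' hpi]
  have hc : HasCompactSupport h := by
    refine HasCompactSupport.intro (isCompact_closedBall (0 : Fin d → ℝ) (2 * π)⁻¹) ?_
    intro z hz
    by_contra hne
    refine hz ?_
    rw [mem_closedBall_zero_iff, pi_norm_le_iff_of_nonneg (by positivity)]
    exact hbox z hne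
  have hdot : ∀ (n : Fin d → ℤ) (z : Fin d → ℝ),
      dotR (zc n) ((2 * π) • z) = 2 * π * dotR (zc n) z := by
    intro n z
    simp only [dotR, Pi.smul_apply, smul_eq_mul, Finset.mul_sum]
    exact Finset.sum_congr rfl fun i _ => by ring
  have hint : ∀ n : Fin d → ℤ,
      ∫ y, Complex.exp (-(Complex.I * (dotR (zc n) y : ℝ))) * k y =
        (2 * π : ℂ) ^ d *
          ∫ y, Complex.exp (-(Complex.I * ((2 * π * dotR (zc n) y : ℝ) : ℂ))) * h y := by
    intro n
    have := Measure.integral_comp_smul (volume : Measure (Fin d → ℝ))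
      (fun y => Complex.exp (-(Complex.I * (dotR (zc n) y : ℝ))) * k y) (2 * π)
    simp only [hdot, Module.finrank_fin_fun] at this
    rw [this, abs_of_pos (by positivity), Complex.real_smul]
    push_cast
    rw [mul_inv_cancel_left₀]
    exact pow_ne_zero _ (by exact_mod_cast hpi.ne')
  have hsum := summable_norm_integral_exp_mul hh hc
  have hco : ∀ n : Fin d → ℤ, UnitAddTorus.mFourierCoeff (torusLift h) n =
      ∫ x, Complex.exp (-(Complex.I * ((2 * π * dotR (zc n) x : ℝ) : ℂ))) * h x :=
    mFourierCoeff_torusLift ha hbox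
  let F : C(UnitAddTorus (Fin d), ℂ) := ⟨torusLift h, continuous_torusLift hh.continuous ha hbox⟩
  have hF : Summable (UnitAddTorus.mFourierCoeff F) := by
    refine Summable.of_norm (hsum.congr fun n => ?_)
    rw [← hco]
    rfl
  let z : Fin d → ℝ := (2 * π)⁻¹ • x
  have hxz : (2 * π) • z = x := smul_inv_smul₀ hpi.ne' x
  have hz : ∀ i, z i ∈ Set.Ioc (-1 / 2 : ℝ) (-1 / 2 + 1) := by
    intro i
    have h1 : |z i| ≤ (2 * π)⁻¹ := by
      simp only [z, Pi.smul_apply, smul_eq_mul, abs_mul]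
      rw [abs_of_pos (inv_pos.2 hpi)]
      exact mul_le_of_le_one_right (by positivity) (hx i)
    have := abs_le.1 h1
    constructor <;> linarith
  have hser := UnitAddTorus.hasSum_mFourier_series_apply_of_summable hF
    (fun i => (z i : UnitAddCircle))
  constructor
  · simp only [hint, norm_mul]
    exact hsum.mul_left _
  · have h2 := hser.mul_left ((2 * π : ℂ) ^ d)
    have h3 : F (fun i => (z i : UnitAddCircle)) = k x := by
      rw [← hxz]
      exact torusLift_coe h hz
    rw [h3] at h2
    refine h2.congr_fun fun n => ?_
    rw [mFourier_coe, ← hdot, hxz, hint, ← hco, smul_eq_mul, mul_assoc]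
    rfl

/-- The smooth, compactly supported function whose Fourier coefficients are the magnetic Gabor
coefficients of `f` at the lattice point `c`. -/
def localPiece {d : ℕ} (φ : (Fin d → ℝ) → (Fin d → ℝ) → ℝ) (g : (Fin d → ℝ) → ℝ)
    (f : (Fin d → ℝ) → ℂ) (c z : Fin d → ℝ) : ℂ :=
  Complex.exp (-(Complex.I * (φ (z + c) c : ℝ))) * (g z : ℝ) * f (z + c)

lemma coefG_eq {d : ℕ} (φ : (Fin d → ℝ) → (Fin d → ℝ) → ℝ) (g : (Fin d → ℝ) → ℝ)
    (f : (Fin d → ℝ) → ℂ) (γ m : Fin d → ℤ) :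
    coefG φ g γ m f = ((2 * π : ℝ) ^ (-(d : ℝ) / 2) : ℝ) *
      ∫ z, Complex.exp (-(Complex.I * (dotR (zc m) z : ℝ))) * localPiece φ g f (zc γ) z := by
  rw [coefG, ← integral_add_right_eq_self _ (zc γ), ← integral_const_mul]
  congr 1
  funext z
  simp only [Gab, localPiece, add_sub_cancel_right, map_mul, Complex.conj_ofReal,
    ← Complex.exp_conj, Complex.conj_I, neg_mul]
  ring

lemma rpow_neg_half_mul_self (d : ℕ) :
    (((2 * π : ℝ) ^ (-(d : ℝ) / 2) : ℝ) : ℂ) * ((2 * π : ℝ) ^ (-(d : ℝ) / 2) : ℝ) *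
      (2 * π : ℂ) ^ d = 1 := by
  have hpi : (0 : ℝ) < 2 * π := by positivity
  have : (2 * π : ℝ) ^ (-(d : ℝ) / 2) * (2 * π : ℝ) ^ (-(d : ℝ) / 2) * (2 * π) ^ d = 1 := by
    rw [← Real.rpow_add hpi, ← Real.rpow_natCast, ← Real.rpow_add hpi]
    ring_nf
    exact Real.rpow_zero _
  exact_mod_cast this

/-- Summing over the frequencies at a fixed lattice point recovers `g(x-γ)^2 f(x)`. -/
lemma hasSum_Gab_mul_coefG {d : ℕ} {g : (Fin d → ℝ) → ℝ} (hg : ContDiff ℝ (⊤ : ℕ∞) g)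
    (hsupp : Function.support g ⊆ Set.univ.pi fun _ => Set.Ioo (-1 : ℝ) 1)
    {φ : (Fin d → ℝ) → (Fin d → ℝ) → ℝ} (hφ : ∀ y, ContDiff ℝ (⊤ : ℕ∞) (fun x => φ x y))
    {f : (Fin d → ℝ) → ℂ} (hf : ContDiff ℝ (⊤ : ℕ∞) f) (x : Fin d → ℝ) (γ : Fin d → ℤ) :
    Summable (fun m : Fin d → ℤ => ‖Gab φ g γ m x * coefG φ g γ m f‖) ∧
    HasSum (fun m : Fin d → ℤ => Gab φ g γ m x * coefG φ g γ m f)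
      ((((g (x - zc γ)) ^ 2 : ℝ) : ℂ) * f x) := by
  by_cases hgx : g (x - zc γ) = 0
  · have h0 : ∀ m, Gab φ g γ m x = 0 := fun m => by simp [Gab, hgx]
    simp [h0, hgx, hasSum_zero]
  have hbox : ∀ z, g z ≠ 0 → ∀ i, |z i| ≤ 1 := fun z hz i =>
    abs_le.2 ⟨(hsupp hz i trivial).1.le, (hsupp hz i trivial).2.le⟩
  have hk : ContDiff ℝ (⊤ : ℕ∞) (localPiece φ g f (zc γ)) := by
    have hadd : ContDiff ℝ (⊤ : ℕ∞) fun z : Fin d → ℝ => z + zc γ := contDiff_id.add contDiff_const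
    have h1 : ContDiff ℝ (⊤ : ℕ∞) fun z : Fin d → ℝ => ((φ (z + zc γ) (zc γ) : ℝ) : ℂ) :=
      Complex.ofRealCLM.contDiff.comp ((hφ (zc γ)).comp hadd)
    have h2 : ContDiff ℝ (⊤ : ℕ∞) fun z : Fin d → ℝ => ((g z : ℝ) : ℂ) :=
      Complex.ofRealCLM.contDiff.comp hg
    exact ((contDiff_const.mul h1).neg.cexp.mul h2).mul (hf.comp hadd)
  obtain ⟨hsum, hser⟩ := hasSum_fourier_of_support_box hk
    (fun z hz => hbox z fun h0 => hz (by simp [localPiece, h0])) (hbox _ hgx)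
  let c : ℂ := (((2 * π : ℝ) ^ (-(d : ℝ) / 2) : ℝ) : ℂ)
  let A : ℂ := c * Complex.exp (Complex.I * (φ x (zc γ) : ℝ)) * (g (x - zc γ) : ℝ) * c
  have hterm : ∀ m : Fin d → ℤ, Gab φ g γ m x * coefG φ g γ m f = A *
      ((∫ z, Complex.exp (-(Complex.I * (dotR (zc m) z : ℝ))) * localPiece φ g f (zc γ) z) *
        Complex.exp (Complex.I * (dotR (zc m) (x - zc γ) : ℝ))) := by
    intro m
    rw [coefG_eq, Gab]
    simp only [A, c]
    ring
  constructor
  · refine (hsum.mul_left ‖A‖).congr fun m => ?_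
    rw [hterm, norm_mul A, norm_mul _ (Complex.exp _), Complex.norm_exp_I_mul_ofReal, mul_one]
  · suffices hval : A * ((2 * π : ℂ) ^ d * localPiece φ g f (zc γ) (x - zc γ)) =
        (((g (x - zc γ)) ^ 2 : ℝ) : ℂ) * f x by
      rw [← hval]
      exact (hser.mul_left A).congr_fun hterm
    simp only [A, c, localPiece, sub_add_cancel]
    have h1 := rpow_neg_half_mul_self d
    have h2 : Complex.exp (Complex.I * (φ x (zc γ) : ℝ)) *
        Complex.exp (-(Complex.I * (φ x (zc γ) : ℝ))) = 1 := by
      rw [← Complex.exp_add, add_neg_cancel, Complex.exp_zero]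
    push_cast at h1 h2 ⊢
    linear_combination
      ((g (x - zc γ) : ℂ) ^ 2 * f x) * h1 +
      ((g (x - zc γ) : ℂ) ^ 2 * f x) * (c * c * (2 * π : ℂ) ^ d) * h2

lemma finite_lattice_translates_ne_zero {d : ℕ} {g : (Fin d → ℝ) → ℝ}
    (hsupp : Function.support g ⊆ Set.univ.pi fun _ => Set.Ioo (-1 : ℝ) 1) (x : Fin d → ℝ) :
    {γ : Fin d → ℤ | g (x - zc γ) ≠ 0}.Finite := by
  refine (Set.finite_Icc (fun i => ⌊x i - 1⌋) fun i => ⌈x i + 1⌉).subset fun γ hγ => ?_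
  have hb : ∀ i, x i - γ i ∈ Set.Ioo (-1 : ℝ) 1 := fun i => hsupp hγ i trivial
  refine ⟨fun i => Int.cast_le.1 ((Int.floor_le (x i - 1)).trans ?_),
    fun i => Int.cast_le.1 (le_trans ?_ (Int.le_ceil (x i + 1)))⟩
  · linarith [(hb i).2]
  · linarith [(hb i).1]

/-- magnetic Gabor frame reconstruction of Schwartz functions,
with the double series absolutely convergent. -/
theorem stmt6 {d : ℕ} (g : (Fin d → ℝ) → ℝ) (hg : ContDiff ℝ (⊤ : ℕ∞) g)
    (hsupp : Function.support g ⊆ Set.univ.pi fun _ => Set.Ioo (-1 : ℝ) 1)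
    (hpart : ∀ x : Fin d → ℝ, HasSum (fun γ : Fin d → ℤ => (g (x - zc γ)) ^ 2) 1)
    (φ : (Fin d → ℝ) → (Fin d → ℝ) → ℝ)
    (hφsmooth : ∀ y, ContDiff ℝ (⊤ : ℕ∞) (fun x => φ x y))
    (hφgrad : ∃ C, ∀ (γ : Fin d → ℤ) (x : Fin d → ℝ),
      ‖fderiv ℝ (fun z => φ z (zc γ)) x‖ ≤ C * (1 + ‖x - zc γ‖))
    (f : SchwartzMap (Fin d → ℝ) ℂ) (x : Fin d → ℝ) :
    Summable (fun p : (Fin d → ℤ) × (Fin d → ℤ) =>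
        ‖Gab φ g p.1 p.2 x * coefG φ g p.1 p.2 (fun y => f y)‖) ∧
      HasSum (fun p : (Fin d → ℤ) × (Fin d → ℤ) =>
        Gab φ g p.1 p.2 x * coefG φ g p.1 p.2 (fun y => f y)) (f x) := by
  have hfib := hasSum_Gab_mul_coefG hg hsupp hφsmooth f.smooth' x
  have hsum : Summable (fun p : (Fin d → ℤ) × (Fin d → ℤ) =>
      ‖Gab φ g p.1 p.2 x * coefG φ g p.1 p.2 (fun y => f y)‖) := by
    refine (summable_prod_of_nonneg fun p => norm_nonneg _).2 ⟨fun γ => (hfib γ).1, ?_⟩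
    refine summable_of_hasFiniteSupport
      ((finite_lattice_translates_ne_zero hsupp x).subset fun γ hγ h0 => hγ ?_)
    simp [Gab, h0]
  refine ⟨hsum, ?_⟩
  have htot := hsum.of_norm.hasSum
  have h1 := htot.prod_fiberwise fun γ => (hfib γ).2
  have h2 : HasSum (fun γ : Fin d → ℤ => (((g (x - zc γ)) ^ 2 : ℝ) : ℂ) * f x) (f x) := by
    simpa using (Complex.hasSum_ofReal.2 (hpart x)).mul_right (f x)
  rwa [h1.unique h2] at htot
end
end

section
/- Define F(u, η, κ') := (2π)^{-d} ∫_{ℝ^d} e^{-iη·s} g(u + (s-κ')/2) g(u - (s-κ')/2) ds for u, η ∈ ℝ^d and κ' ∈ ℤ^d, with g ∈ C_c^∞((-1,1)^d). Then for all multi-indices α, β there is C(α,β) such that |D_u^α D_η^β F(u, η, κ')| ≤ C(α,β) ⟨η⟩^{-2d} ⟨κ'⟩^{|β|} uniformly in u, η, κ'. -/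
noncomputable section
open MeasureTheory Real Complex

/-- `F(u, η, κ') = (2π)^{-d} ∫ e^{-iη·s} g(u + (s-κ')/2) g(u - (s-κ')/2) ds`. -/
def Ffun {d : ℕ} (g : (Fin d → ℝ) → ℝ) (u η : Fin d → ℝ) (κ : Fin d → ℤ) : ℂ :=
  (((2 * π : ℝ) ^ d)⁻¹ : ℝ) *
    ∫ s : Fin d → ℝ, Complex.exp (-Complex.I * (dotR η s : ℝ)) *
      (g (u + (2 : ℝ)⁻¹ • (s - zc κ)) : ℝ) * (g (u - (2 : ℝ)⁻¹ • (s - zc κ)) : ℝ)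


open scoped ContDiff

/-- The Euclidean dot product as a continuous bilinear map. -/
def dotL (d : ℕ) : (Fin d → ℝ) →L[ℝ] (Fin d → ℝ) →L[ℝ] ℝ :=
  ∑ i, (ContinuousLinearMap.proj (R := ℝ) (φ := fun _ : Fin d => ℝ) i).smulRight
    (ContinuousLinearMap.proj (R := ℝ) (φ := fun _ : Fin d => ℝ) i)

lemma dotL_apply {d : ℕ} (a b : Fin d → ℝ) : dotL d a b = dotR a b := by
  simp [dotL, dotR]

lemma dotR_comm {d : ℕ} (a b : Fin d → ℝ) : dotR a b = dotR b a := by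
  simp [dotR, mul_comm]

lemma abs_dotR_le {d : ℕ} (a b : Fin d → ℝ) : |dotR a b| ≤ d * ‖a‖ * ‖b‖ := by
  calc |dotR a b| ≤ ∑ i : Fin d, |a i * b i| := Finset.abs_sum_le_sum_abs _ _
    _ ≤ ∑ _i : Fin d, ‖a‖ * ‖b‖ := by
      refine Finset.sum_le_sum fun i _ => ?_
      rw [abs_mul]
      exact mul_le_mul (norm_le_pi_norm a i) (norm_le_pi_norm b i) (abs_nonneg _) (norm_nonneg _)
    _ = d * ‖a‖ * ‖b‖ := by simp [mul_assoc]

/-- The oscillating factor `e^{-iη·t}`. -/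
def phase {d : ℕ} (η t : Fin d → ℝ) : ℂ := Complex.exp (-Complex.I * (dotR η t : ℝ))

lemma norm_phase {d : ℕ} (η t : Fin d → ℝ) : ‖phase η t‖ = 1 := by
  simp [phase, Complex.norm_exp]

lemma phase_comm {d : ℕ} (η t : Fin d → ℝ) : phase η t = phase t η := by
  rw [phase, phase, dotR_comm]

lemma phase_add_right {d : ℕ} (η s t : Fin d → ℝ) :
    phase η (s + t) = phase η s * phase η t := by
  simp only [phase, ← dotL_apply, map_add, ← Complex.exp_add]
  push_cast
  ring_nf

lemma phase_smul_comm {d : ℕ} (c : ℝ) (η t : Fin d → ℝ) :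
    phase (c • η) t = phase η (c • t) := by
  simp [phase, ← dotL_apply]

lemma hasFDerivAt_phase_left {d : ℕ} (η t : Fin d → ℝ) :
    HasFDerivAt (fun η' => phase η' t)
      (((dotL d).flip t).smulRight (-Complex.I * phase η t)) η := by
  have h1 : HasFDerivAt (fun η' => dotR η' t) ((dotL d).flip t) η := by
    have : (fun η' => dotR η' t) = (dotL d).flip t := by ext; simp [dotL_apply]
    rw [this]
    exact ((dotL d).flip t).hasFDerivAt
  have h2 : HasDerivAt (fun r : ℝ => Complex.exp (-Complex.I * (r : ℝ)))
      (-Complex.I * phase η t) (dotR η t) := by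
    have := ((Complex.ofRealCLM.hasDerivAt (x := dotR η t)).const_mul (-Complex.I)).cexp
    simpa [phase, mul_comm] using this
  refine (h2.hasFDerivAt.comp η h1).congr_fderiv ?_
  ext v
  simp [ContinuousLinearMap.smulRight]

lemma continuous_phase {d : ℕ} (η : Fin d → ℝ) : Continuous (phase η) := by
  unfold phase dotR
  fun_prop

section PartialFourier

variable {d : ℕ} {W : Type*} [NormedAddCommGroup W] [NormedSpace ℝ W] [NormedSpace ℂ W]
  [IsScalarTower ℝ ℂ W] {K : (Fin d → ℝ) × (Fin d → ℝ) → W}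

/-- The Fourier transform of `K` in its second variable. -/
def partialFourier (K : (Fin d → ℝ) × (Fin d → ℝ) → W) (x : (Fin d → ℝ) × (Fin d → ℝ)) : W :=
  ∫ t, phase x.2 t • K (x.1, t)

omit [NormedSpace ℝ W] [NormedSpace ℂ W] [IsScalarTower ℝ ℂ W] in
lemma exists_norm_le_indicator (hK : Continuous K) (hc : HasCompactSupport K) :
    ∃ b : (Fin d → ℝ) → ℝ, Integrable b ∧ ∀ u t, ‖K (u, t)‖ ≤ b t := by
  obtain ⟨M, hM⟩ := hc.exists_bound_of_continuous hK
  have hS : IsCompact (Prod.snd '' tsupport K) := hc.isCompact.image continuous_snd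
  refine ⟨(Prod.snd '' tsupport K).indicator fun _ => M,
    (integrable_indicator_iff hS.measurableSet).2 (integrableOn_const hS.measure_lt_top.ne),
    fun u t => ?_⟩
  by_cases ht : t ∈ Prod.snd '' tsupport K
  · simpa [Set.indicator_of_mem ht] using hM (u, t)
  · have : (u, t) ∉ tsupport K := fun h => ht ⟨_, h, rfl⟩
    rw [Set.indicator_of_notMem ht, image_eq_zero_of_notMem_tsupport this, norm_zero]

omit [NormedSpace ℝ W] [IsScalarTower ℝ ℂ W] in
lemma integrable_phase_smul (hK : Continuous K) (hc : HasCompactSupport K)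
    (x : (Fin d → ℝ) × (Fin d → ℝ)) : Integrable fun t => phase x.2 t • K (x.1, t) := by
  obtain ⟨b, hb, hle⟩ := exists_norm_le_indicator hK hc
  have hcont : Continuous fun t => phase x.2 t • K (x.1, t) :=
    (continuous_phase x.2).smul (by fun_prop)
  refine hb.mono' hcont.aestronglyMeasurable (.of_forall fun t => ?_)
  rw [norm_smul, norm_phase, one_mul]
  exact hle _ _

omit [IsScalarTower ℝ ℂ W] in
lemma exists_norm_partialFourier_le (hK : Continuous K) (hc : HasCompactSupport K) :
    ∃ C, ∀ x, ‖partialFourier K x‖ ≤ C := by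
  obtain ⟨b, hb, hle⟩ := exists_norm_le_indicator hK hc
  refine ⟨∫ t, b t, fun x => norm_integral_le_of_norm_le hb (.of_forall fun t => ?_)⟩
  rw [norm_smul, norm_phase, one_mul]
  exact hle _ _

/-- The function whose partial Fourier transform is the derivative of that of `K`. -/
def derivKernel (K : (Fin d → ℝ) × (Fin d → ℝ) → W) (y : (Fin d → ℝ) × (Fin d → ℝ)) :
    (Fin d → ℝ) × (Fin d → ℝ) →L[ℝ] W :=
  (fderiv ℝ K y).comp
      ((ContinuousLinearMap.inl ℝ _ _).comp (ContinuousLinearMap.fst ℝ _ _)) +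
    (((dotL d).flip y.2).comp (ContinuousLinearMap.snd ℝ _ _)).smulRight (-Complex.I • K y)

lemma contDiff_derivKernel (hK : ContDiff ℝ ∞ K) : ContDiff ℝ ∞ (derivKernel K) := by
  refine ContDiff.add ?_ ?_
  · exact (hK.fderiv_right (by simp)).clm_comp contDiff_const
  · refine ContDiff.smulRight ?_ (hK.const_smul _)
    exact ((dotL d).flip.contDiff.comp contDiff_snd).clm_comp contDiff_const

omit [IsScalarTower ℝ ℂ W] in
lemma hasCompactSupport_derivKernel (hc : HasCompactSupport K) :
    HasCompactSupport (derivKernel K) := by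
  refine HasCompactSupport.intro hc.isCompact fun y hy => ?_
  have h1 : fderiv ℝ K y = 0 :=
    image_eq_zero_of_notMem_tsupport fun h => hy (tsupport_fderiv_subset ℝ h)
  ext v <;> simp [derivKernel, h1, image_eq_zero_of_notMem_tsupport hy]

lemma hasFDerivAt_phase_smul (hK : ContDiff ℝ ∞ K) (t : Fin d → ℝ)
    (x : (Fin d → ℝ) × (Fin d → ℝ)) :
    HasFDerivAt (fun x : (Fin d → ℝ) × (Fin d → ℝ) => phase x.2 t • K (x.1, t))
      (phase x.2 t • derivKernel K (x.1, t)) x := by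
  have hp : HasFDerivAt (fun x : (Fin d → ℝ) × (Fin d → ℝ) => phase x.2 t)
      ((((dotL d).flip t).smulRight (-Complex.I * phase x.2 t)).comp
        (ContinuousLinearMap.snd ℝ _ _)) x :=
    (hasFDerivAt_phase_left x.2 t).comp x hasFDerivAt_snd
  have hk : HasFDerivAt (fun x : (Fin d → ℝ) × (Fin d → ℝ) => K (x.1, t))
      ((fderiv ℝ K (x.1, t)).comp ((ContinuousLinearMap.fst ℝ _ _).prod 0)) x :=
    ((hK.differentiable (by simp)) (x.1, t)).hasFDerivAt.comp x
      (hasFDerivAt_fst.prodMk (hasFDerivAt_const t x))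
  refine (hp.smul hk).congr_fderiv ?_
  refine ContinuousLinearMap.ext fun v => ?_
  have : dotL d v.2 t • (Complex.I * phase x.2 t) • K (x.1, t) =
      (Complex.I * (phase x.2 t * (dotL d v.2 t : ℂ))) • K (x.1, t) := by
    rw [← smul_assoc, Complex.real_smul]
    ring_nf
  simp [derivKernel, smul_smul, mul_comm, mul_assoc, smul_comm _ (dotL d _ _), this]

lemma hasFDerivAt_partialFourier (hK : ContDiff ℝ ∞ K) (hc : HasCompactSupport K)
    (x : (Fin d → ℝ) × (Fin d → ℝ)) :
    HasFDerivAt (partialFourier K) (partialFourier (derivKernel K) x) x := by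
  have hK' := (contDiff_derivKernel hK).continuous
  have hc' := hasCompactSupport_derivKernel hc
  obtain ⟨b, hb, hle⟩ := exists_norm_le_indicator hK' hc'
  have hint := integrable_phase_smul hK.continuous hc
  have hmeas := (integrable_phase_smul hK' hc' x).aestronglyMeasurable
  have hbound : ∀ t, ∀ x ∈ Set.univ, ‖phase (Prod.snd x) t • derivKernel K (x.1, t)‖ ≤ b t := by
    intro t x _
    rw [norm_smul, norm_phase, one_mul]
    exact hle _ _
  exact hasFDerivAt_integral_of_dominated_of_fderiv_le (s := Set.univ) Filter.univ_mem
    (.of_forall fun x => (hint x).aestronglyMeasurable) (hint x) hmeas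
    (.of_forall hbound) hb (.of_forall fun t x _ => hasFDerivAt_phase_smul hK t x)

lemma exists_norm_pow_mul_partialFourier_le (n : ℕ) :
    ∀ {K : (Fin d → ℝ) × (Fin d → ℝ) → W}, ContDiff ℝ ∞ K → HasCompactSupport K →
    ∃ C, ∀ x, ‖x.2‖ ^ n * ‖partialFourier K x‖ ≤ C := by
  induction n with
  | zero =>
    intro K hK hc
    simpa using exists_norm_partialFourier_le hK.continuous hc
  | succ n ih =>
    intro K hK hc
    let D : Fin d → (Fin d → ℝ) × (Fin d → ℝ) → W := fun j y => fderiv ℝ K y (0, Pi.single j 1)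
    have hD (j) : ContDiff ℝ ∞ (D j) := (hK.fderiv_right (by simp)).clm_apply contDiff_const
    have hDc (j) : HasCompactSupport (D j) := hc.fderiv_apply ℝ _
    choose C hC using fun j => ih (hD j) (hDc j)
    have hC0 (j) : 0 ≤ C j := le_trans (by positivity) (hC j 0)
    have key (j x) : |x.2 j| * ‖partialFourier K x‖ = ‖partialFourier (D j) x‖ := by
      let v : Fin d → ℝ := Pi.single j 1
      have hφ (t) : HasFDerivAt (phase x.2)
          (((dotL d).flip x.2).smulRight (-Complex.I * phase t x.2)) t := by
        simpa [funext (phase_comm x.2)] using hasFDerivAt_phase_left t x.2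
      have hφv (t) : ((dotL d).flip x.2).smulRight (-Complex.I * phase t x.2) v =
          (-Complex.I * x.2 j) * phase x.2 t := by
        simp [v, dotL_apply, dotR, Pi.single_apply, phase_comm t]
        ring
      have hk (t) : HasFDerivAt (fun t => K (x.1, t))
          ((fderiv ℝ K (x.1, t)).comp (ContinuousLinearMap.inr ℝ _ _)) t := by
        refine ((hK.differentiable (by simp)) (x.1, t)).hasFDerivAt.comp t ?_
        exact hasFDerivAt_prodMk_right _ _
      have ibp := integral_bilinear_hasFDerivAt_right_eq_neg_left_of_integrable (v := v)
        (μ := volume) (f := phase x.2) (g := fun t => K (x.1, t))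
        (B := ContinuousLinearMap.lsmul ℝ ℂ) ?_ ?_ ?_ (fun t _ => hφ t) (fun t _ => hk t)
      · have h2 : partialFourier (D j) x = (Complex.I * x.2 j) • partialFourier K x := by
          simp only [ContinuousLinearMap.lsmul_apply, hφv, mul_smul _ (phase _ _)] at ibp
          rw [integral_smul (-Complex.I * (x.2 j : ℂ))] at ibp
          refine (Eq.trans ?_ ibp).trans ?_
          · simp [partialFourier, D, v]
          · rw [← neg_smul]; simp [partialFourier]
        rw [h2, norm_smul]
        simp
      · simp only [ContinuousLinearMap.lsmul_apply, hφv, mul_smul _ (phase _ _)]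
        exact (integrable_phase_smul hK.continuous hc x).smul (-Complex.I * (x.2 j : ℂ))
      · simpa [D, v] using integrable_phase_smul (hD j).continuous (hDc j) x
      · exact integrable_phase_smul hK.continuous hc x
    refine ⟨∑ j, C j, fun x => ?_⟩
    by_cases hx : ‖x.2‖ = 0
    · simpa [hx] using Finset.sum_nonneg fun j _ => hC0 j
    have : Nonempty (Fin d) := by
      by_contra h
      rw [not_nonempty_iff] at h
      exact hx (by simp [Subsingleton.elim x.2 0])
    obtain ⟨j, hj⟩ := Finite.exists_max fun j => |x.2 j|
    have hj' : ‖x.2‖ = |x.2 j| :=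
      le_antisymm ((pi_norm_le_iff_of_nonneg (abs_nonneg _)).2 hj) (norm_le_pi_norm x.2 j)
    calc ‖x.2‖ ^ (n + 1) * ‖partialFourier K x‖
        = ‖x.2‖ ^ n * (|x.2 j| * ‖partialFourier K x‖) := by rw [pow_succ, ← hj', mul_assoc]
      _ = ‖x.2‖ ^ n * ‖partialFourier (D j) x‖ := by rw [key]
      _ ≤ C j := hC j x
      _ ≤ ∑ j, C j := Finset.single_le_sum (fun j _ => hC0 j) (Finset.mem_univ j)

lemma exists_norm_partialFourier_le_rpow (N : ℕ) (hK : ContDiff ℝ ∞ K)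
    (hc : HasCompactSupport K) :
    ∃ C, 0 ≤ C ∧ ∀ x, ‖partialFourier K x‖ ≤ C * (1 + ‖x.2‖ ^ 2) ^ (-(N : ℝ)) := by
  obtain ⟨A, hA⟩ := exists_norm_pow_mul_partialFourier_le 0 hK hc
  obtain ⟨B, hB⟩ := exists_norm_pow_mul_partialFourier_le (2 * N) hK hc
  have hA0 : 0 ≤ A := le_trans (by positivity) (hA 0)
  have hB0 : 0 ≤ B := le_trans (by positivity) (hB 0)
  refine ⟨2 ^ (N - 1) * (A + B), by positivity, fun x => ?_⟩
  rw [Real.rpow_neg (by positivity), Real.rpow_natCast, ← div_eq_mul_inv,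
    le_div_iff₀ (by positivity)]
  calc ‖partialFourier K x‖ * (1 + ‖x.2‖ ^ 2) ^ N
      ≤ ‖partialFourier K x‖ * (2 ^ (N - 1) * (1 ^ N + (‖x.2‖ ^ 2) ^ N)) := by
        gcongr
        exact add_pow_le zero_le_one (by positivity) N
    _ = 2 ^ (N - 1) * (‖x.2‖ ^ 0 * ‖partialFourier K x‖ +
          ‖x.2‖ ^ (2 * N) * ‖partialFourier K x‖) := by rw [one_pow, pow_mul]; ring
    _ ≤ 2 ^ (N - 1) * (A + B) := by gcongr; exacts [hA x, hB x]

lemma contDiff_partialFourier (hK : ContDiff ℝ ∞ K) (hc : HasCompactSupport K) :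
    ContDiff ℝ ∞ (partialFourier K) := by
  rw [contDiff_infty]
  intro n
  induction n generalizing W with
  | zero =>
    exact contDiff_zero.2 (continuous_iff_continuousAt.2 fun x =>
      (hasFDerivAt_partialFourier hK hc x).continuousAt)
  | succ n ih =>
    push_cast
    rw [contDiff_succ_iff_hasFDerivAt]
    exact ⟨_, ih (contDiff_derivKernel hK) (hasCompactSupport_derivKernel hc),
      hasFDerivAt_partialFourier hK hc⟩

lemma exists_norm_iteratedFDeriv_partialFourier_le (N m : ℕ) (hK : ContDiff ℝ ∞ K)
    (hc : HasCompactSupport K) :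
    ∃ C, 0 ≤ C ∧ ∀ x, ‖iteratedFDeriv ℝ m (partialFourier K) x‖ ≤
      C * (1 + ‖x.2‖ ^ 2) ^ (-(N : ℝ)) := by
  induction m generalizing W with
  | zero => simpa using exists_norm_partialFourier_le_rpow N hK hc
  | succ m ih =>
    have h : fderiv ℝ (partialFourier K) = partialFourier (derivKernel K) :=
      funext fun x => (hasFDerivAt_partialFourier hK hc x).fderiv
    simpa only [← norm_iteratedFDeriv_fderiv, h] using
      ih (contDiff_derivKernel hK) (hasCompactSupport_derivKernel hc)

end PartialFourier

section IteratedFDeriv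

variable {X Y W : Type*} [NormedAddCommGroup X] [NormedSpace ℝ X] [NormedAddCommGroup Y]
  [NormedSpace ℝ Y] [NormedAddCommGroup W] [NormedSpace ℝ W]

lemma norm_iteratedFDeriv_comp_clm_le {f : Y → W} (hf : ContDiff ℝ ∞ f) (A : X →L[ℝ] Y)
    (n : ℕ) (x : X) :
    ‖iteratedFDeriv ℝ n (fun x => f (A x)) x‖ ≤ ‖iteratedFDeriv ℝ n f (A x)‖ * ‖A‖ ^ n := by
  have := A.iteratedFDeriv_comp_right hf x (i := n) (by exact_mod_cast le_top)
  rw [Function.comp_def] at this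
  rw [this]
  simpa using ContinuousMultilinearMap.norm_compContinuousLinearMap_le
    (iteratedFDeriv ℝ n f (A x)) fun _ => A

lemma norm_iteratedFDeriv_iteratedFDeriv (f : X → W) (a : ℕ) :
    ∀ (b : ℕ) (x : X),
      ‖iteratedFDeriv ℝ a (iteratedFDeriv ℝ b f) x‖ = ‖iteratedFDeriv ℝ (a + b) f x‖ := by
  induction a with
  | zero =>
    intro b x
    rw [norm_iteratedFDeriv_zero, zero_add]
  | succ a ih =>
    intro b x
    rw [← norm_iteratedFDeriv_fderiv, fderiv_iteratedFDeriv,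
      LinearIsometryEquiv.norm_iteratedFDeriv_comp_left, ih,
      show a + (b + 1) = a + 1 + b by ring]

lemma norm_iteratedFDeriv_iteratedFDeriv_prod_le {H : X × Y → W} (hH : ContDiff ℝ ∞ H)
    (c : ℝ) (a b : ℕ) (u : X) (η : Y) :
    ‖iteratedFDeriv ℝ a (fun u => iteratedFDeriv ℝ b (fun η => H (u, c • η)) η) u‖ ≤
      ‖iteratedFDeriv ℝ (a + b) H (u, c • η)‖ * |c| ^ b := by
  let A : Y →L[ℝ] X × Y := c • ContinuousLinearMap.inr ℝ X Y
  have hA : ‖A‖ ≤ |c| := by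
    refine (norm_smul_le c (ContinuousLinearMap.inr ℝ X Y)).trans ?_
    exact mul_le_of_le_one_right (abs_nonneg _) (ContinuousLinearMap.norm_inr_le_one ℝ X Y)
  let L := ContinuousMultilinearMap.compContinuousLinearMapL (𝕜 := ℝ) (F := W) (fun _ : Fin b => A)
  have hL : ‖L‖ ≤ |c| ^ b := by
    refine (ContinuousMultilinearMap.norm_compContinuousLinearMapL_le W fun _ : Fin b => A).trans ?_
    simpa using pow_le_pow_left₀ (norm_nonneg _) hA b
  have hin (u : X) : iteratedFDeriv ℝ b (fun η => H (u, c • η)) η =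
      L (iteratedFDeriv ℝ b H ((0, c • η) + ContinuousLinearMap.inl ℝ X Y u)) := by
    have h1 : (fun η => H (u, c • η)) = (fun z => H ((u, 0) + z)) ∘ A := by
      ext η
      simp [A]
    have h2 : ContDiff ℝ ∞ fun z => H ((u, 0) + z) := hH.comp (contDiff_const.add contDiff_id)
    rw [h1, A.iteratedFDeriv_comp_right h2 η (by exact_mod_cast le_top),
      iteratedFDeriv_comp_add_left]
    simp [L, A]
  simp_rw [hin]
  have hD : ContDiff ℝ ∞ (iteratedFDeriv ℝ b H) :=
    hH.iteratedFDeriv_right (by exact_mod_cast le_top)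
  have hD' : ContDiff ℝ ∞ fun z => iteratedFDeriv ℝ b H ((0, c • η) + z) :=
    hD.comp (contDiff_const.add contDiff_id)
  have hD'' := hD'.comp (ContinuousLinearMap.inl ℝ X Y).contDiff
  have h3 := L.norm_iteratedFDeriv_comp_left hD''.contDiffAt (x := u) (n := a)
    (by exact_mod_cast le_top)
  have h4 := norm_iteratedFDeriv_comp_clm_le hD' (ContinuousLinearMap.inl ℝ X Y) a u
  rw [iteratedFDeriv_comp_add_left, norm_iteratedFDeriv_iteratedFDeriv] at h4
  have h5 : ‖ContinuousLinearMap.inl ℝ X Y‖ ^ a ≤ 1 :=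
    pow_le_one₀ (norm_nonneg _) (ContinuousLinearMap.norm_inl_le_one ℝ X Y)
  have h6 : (0, c • η) + ContinuousLinearMap.inl ℝ X Y u = (u, c • η) := by simp
  rw [h6] at h4
  refine h3.trans ((mul_le_mul hL (h4.trans (mul_le_of_le_one_right (norm_nonneg _) h5))
    (norm_nonneg _) (by positivity)).trans_eq (mul_comm _ _))

end IteratedFDeriv

lemma contDiff_phase {d : ℕ} (θ : Fin d → ℝ) : ContDiff ℝ ∞ fun η => phase η θ := by
  simp_rw [phase, ← dotL_apply]
  exact (contDiff_const.mul
    (Complex.ofRealCLM.contDiff.comp ((dotL d).flip θ).contDiff)).cexp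

lemma norm_iteratedFDeriv_phase_le {d : ℕ} (θ η : Fin d → ℝ) (n : ℕ) :
    ‖iteratedFDeriv ℝ n (fun η => phase η θ) η‖ ≤ (d * ‖θ‖) ^ n := by
  let e : ℝ → ℂ := fun r => Complex.exp (-Complex.I * (r : ℝ))
  have he (r : ℝ) : HasDerivAt e (-Complex.I * e r) r := by
    simpa [e, mul_comm] using
      ((Complex.ofRealCLM.hasDerivAt (x := r)).const_mul (-Complex.I)).cexp
  have hite : iteratedDeriv n e = fun r => (-Complex.I) ^ n * e r := by
    induction n with
    | zero => simp
    | succ n ih =>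
      ext r
      rw [iteratedDeriv_succ, ih, ((he r).const_mul _).deriv]
      ring
  have hsm : ContDiff ℝ ∞ e :=
    (contDiff_const.mul Complex.ofRealCLM.contDiff).cexp
  have h := norm_iteratedFDeriv_comp_clm_le hsm ((dotL d).flip θ) n η
  have h1 : ‖(dotL d).flip θ‖ ≤ d * ‖θ‖ := by
    refine ContinuousLinearMap.opNorm_le_bound _ (by positivity) fun v => ?_
    rw [ContinuousLinearMap.flip_apply, dotL_apply, Real.norm_eq_abs]
    exact (abs_dotR_le _ _).trans_eq (by ring)
  have h2 : (fun η => e ((dotL d).flip θ η)) = fun η => phase η θ := by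
    ext η
    simp [e, phase, dotL_apply]
  rw [h2, norm_iteratedFDeriv_eq_norm_iteratedDeriv, hite] at h
  refine h.trans ?_
  simpa [e, Complex.norm_exp] using pow_le_pow_left₀ (norm_nonneg _) h1 n

/-- The product `g(u + t/2) g(u - t/2)`. -/
def productKernel {d : ℕ} (g : (Fin d → ℝ) → ℝ) (x : (Fin d → ℝ) × (Fin d → ℝ)) : ℂ :=
  (g (x.1 + (2 : ℝ)⁻¹ • x.2) : ℂ) * (g (x.1 - (2 : ℝ)⁻¹ • x.2) : ℂ)

lemma contDiff_productKernel {d : ℕ} {g : (Fin d → ℝ) → ℝ} (hg : ContDiff ℝ ∞ g) :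
    ContDiff ℝ ∞ (productKernel g) := by
  have hc : ContDiff ℝ ∞ ((↑) : ℝ → ℂ) := Complex.ofRealCLM.contDiff
  exact (hc.comp (hg.comp (by fun_prop))).mul (hc.comp (hg.comp (by fun_prop)))

lemma hasCompactSupport_productKernel {d : ℕ} {g : (Fin d → ℝ) → ℝ}
    (hsupp : Function.support g ⊆ Set.univ.pi fun _ => Set.Ioo (-1 : ℝ) 1) :
    HasCompactSupport (productKernel g) := by
  refine HasCompactSupport.intro (isCompact_closedBall 0 2) fun x hx => ?_
  by_contra hne
  obtain ⟨h1, h2⟩ : g (x.1 + (2 : ℝ)⁻¹ • x.2) ≠ 0 ∧ g (x.1 - (2 : ℝ)⁻¹ • x.2) ≠ 0 := by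
    simpa [productKernel] using hne
  have h1 := hsupp h1
  have h2 := hsupp h2
  simp only [Set.mem_pi, Set.mem_univ, true_implies, Set.mem_Ioo, Pi.add_apply, Pi.sub_apply,
    Pi.smul_apply, smul_eq_mul] at h1 h2
  refine hx (mem_closedBall_zero_iff.2 (norm_prod_le_iff.2 ⟨?_, ?_⟩)) <;>
  · refine (pi_norm_le_iff_of_nonneg zero_le_two).2 fun i => abs_le.2 ?_
    constructor <;> linarith [(h1 i).1, (h1 i).2, (h2 i).1, (h2 i).2]

lemma Ffun_eq {d : ℕ} (g : (Fin d → ℝ) → ℝ) (u η : Fin d → ℝ) (κ : Fin d → ℤ) :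
    Ffun g u η κ = (((2 * π : ℝ) ^ d)⁻¹ : ℝ) *
      (phase η (zc κ) * partialFourier (productKernel g) (u, η)) := by
  rw [Ffun, partialFourier, ← smul_eq_mul (phase η (zc κ)), ← integral_smul,
    ← integral_add_right_eq_self _ (zc κ)]
  congr 2
  ext t
  rw [← phase, phase_add_right, add_sub_cancel_right]
  simp only [productKernel, smul_eq_mul]
  ring

/-- `F` at lattice point `c⁻¹ θ`, with the frequency variable rescaled by `c`. -/
def rescaledF {d : ℕ} (g : (Fin d → ℝ) → ℝ) (c : ℝ) (θ : Fin d → ℝ)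
    (x : (Fin d → ℝ) × (Fin d → ℝ)) : ℂ :=
  (((2 * π : ℝ) ^ d)⁻¹ : ℝ) • (phase x.2 θ * partialFourier (productKernel g) (x.1, c • x.2))

lemma contDiff_rescaledF {d : ℕ} {g : (Fin d → ℝ) → ℝ} (hg : ContDiff ℝ ∞ g)
    (hsupp : Function.support g ⊆ Set.univ.pi fun _ => Set.Ioo (-1 : ℝ) 1)
    (c : ℝ) (θ : Fin d → ℝ) : ContDiff ℝ ∞ (rescaledF g c θ) := by
  have hP := contDiff_partialFourier (contDiff_productKernel hg)
    (hasCompactSupport_productKernel hsupp)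
  exact (((contDiff_phase θ).comp contDiff_snd).mul (hP.comp (by fun_prop))).const_smul _

lemma exists_norm_iteratedFDeriv_rescaledF_le {d : ℕ} {g : (Fin d → ℝ) → ℝ}
    (hg : ContDiff ℝ ∞ g)
    (hsupp : Function.support g ⊆ Set.univ.pi fun _ => Set.Ioo (-1 : ℝ) 1) (N n : ℕ) :
    ∃ C, ∀ (c : ℝ) (θ : Fin d → ℝ), |c| ≤ 1 → ‖θ‖ ≤ 1 → ∀ x,
      ‖iteratedFDeriv ℝ n (rescaledF g c θ) x‖ ≤ C * (1 + ‖c • x.2‖ ^ 2) ^ (-(N : ℝ)) := by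
  have hK := contDiff_productKernel hg
  have hc := hasCompactSupport_productKernel hsupp
  have hP := contDiff_partialFourier hK hc
  choose C hC0 hC using fun m => exists_norm_iteratedFDeriv_partialFourier_le N m hK hc
  refine ⟨((2 * π : ℝ) ^ d)⁻¹ * ∑ i ∈ Finset.range (n + 1), (n.choose i : ℝ) * d ^ i * C (n - i),
    fun c θ hcle hθ x => ?_⟩
  let A : (Fin d → ℝ) × (Fin d → ℝ) →L[ℝ] (Fin d → ℝ) × (Fin d → ℝ) :=
    (ContinuousLinearMap.fst ℝ _ _).prod (c • ContinuousLinearMap.snd ℝ _ _)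
  have hA : ‖A‖ ≤ 1 := by
    refine ContinuousLinearMap.opNorm_le_bound _ zero_le_one fun v => ?_
    rw [one_mul]
    refine norm_prod_le_iff.2 ⟨norm_fst_le v, ?_⟩
    calc ‖c • v.2‖ = |c| * ‖v.2‖ := by rw [norm_smul, Real.norm_eq_abs]
      _ ≤ ‖v.2‖ := mul_le_of_le_one_left (norm_nonneg _) hcle
      _ ≤ ‖v‖ := norm_snd_le v
  have hphase (i : ℕ) : ‖iteratedFDeriv ℝ i
      (fun x : (Fin d → ℝ) × (Fin d → ℝ) => phase x.2 θ) x‖ ≤ d ^ i := by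
    refine (norm_iteratedFDeriv_comp_clm_le (contDiff_phase θ)
      (ContinuousLinearMap.snd ℝ (Fin d → ℝ) (Fin d → ℝ)) i x).trans ?_
    refine (mul_le_of_le_one_right (norm_nonneg _)
      (pow_le_one₀ (norm_nonneg _) (ContinuousLinearMap.norm_snd_le ℝ _ _))).trans ?_
    refine (norm_iteratedFDeriv_phase_le θ _ i).trans ?_
    gcongr
    exact mul_le_of_le_one_right (by positivity) hθ
  have hfourier (m : ℕ) : ‖iteratedFDeriv ℝ m
      (fun x => partialFourier (productKernel g) (A x)) x‖ ≤
        C m * (1 + ‖c • x.2‖ ^ 2) ^ (-(N : ℝ)) :=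
    (norm_iteratedFDeriv_comp_clm_le hP A m x).trans <|
      (mul_le_of_le_one_right (norm_nonneg _) (pow_le_one₀ (norm_nonneg _) hA)).trans (hC m (A x))
  have hs1 : ContDiff ℝ ∞ fun x : (Fin d → ℝ) × (Fin d → ℝ) => phase x.2 θ :=
    (contDiff_phase θ).comp contDiff_snd
  have hs2 : ContDiff ℝ ∞ fun x => partialFourier (productKernel g) (A x) := hP.comp A.contDiff
  have hconst : iteratedFDeriv ℝ n (rescaledF g c θ) x = (((2 * π : ℝ) ^ d)⁻¹ : ℝ) •
      iteratedFDeriv ℝ n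
        (fun x => phase x.2 θ * partialFourier (productKernel g) (A x)) x :=
    iteratedFDeriv_const_smul_apply (a := (((2 * π : ℝ) ^ d)⁻¹ : ℝ))
      ((hs1.mul hs2).of_le (by exact_mod_cast le_top)).contDiffAt
  rw [hconst, norm_smul, Real.norm_of_nonneg (by positivity), mul_assoc, Finset.sum_mul]
  gcongr
  refine (norm_iteratedFDeriv_mul_le hs1 hs2 x (by exact_mod_cast le_top)).trans ?_
  refine Finset.sum_le_sum fun i _ => ?_
  rw [mul_assoc _ (C _)]
  gcongr
  exacts [hphase i, hfourier _]

/-- `|D_u^α D_η^β F(u, η, κ')| ≤ C(α,β) ⟨η⟩^{-2d} ⟨κ'⟩^{|β|}`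
uniformly in `u`, `η`, `κ'`. -/
theorem stmt13 {d : ℕ} (g : (Fin d → ℝ) → ℝ) (hg : ContDiff ℝ (⊤ : ℕ∞) g)
    (hsupp : Function.support g ⊆ Set.univ.pi fun _ => Set.Ioo (-1 : ℝ) 1) :
    ∀ a b : ℕ, ∃ C, ∀ (u η : Fin d → ℝ) (κ : Fin d → ℤ),
      ‖iteratedFDeriv ℝ a
          (fun u' : Fin d → ℝ => iteratedFDeriv ℝ b (fun η' : Fin d → ℝ => Ffun g u' η' κ) η)
          u‖ ≤
        C * (1 + ‖η‖ ^ 2) ^ (-(d : ℝ)) * (1 + ‖zc κ‖ ^ 2) ^ ((b : ℝ) / 2) := by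
  intro a b
  obtain ⟨C, hC⟩ := exists_norm_iteratedFDeriv_rescaledF_le hg hsupp d (a + b)
  refine ⟨C, fun u η κ => ?_⟩
  let l : ℝ := √(1 + ‖zc κ‖ ^ 2)
  have hl1 : 1 ≤ l := Real.one_le_sqrt.2 (by nlinarith [sq_nonneg ‖zc κ‖])
  have hl0 : 0 < l := by positivity
  have hκ : ‖zc κ‖ ≤ l := Real.le_sqrt_of_sq_le (by linarith)
  have hF (u η : Fin d → ℝ) : Ffun g u η κ = rescaledF g l⁻¹ (l⁻¹ • zc κ) (u, l • η) := by
    rw [Ffun_eq, rescaledF, phase_smul_comm, smul_smul, smul_smul, mul_inv_cancel₀ hl0.ne',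
      inv_mul_cancel₀ hl0.ne', one_smul, one_smul, Complex.real_smul]
  simp_rw [hF]
  refine (norm_iteratedFDeriv_iteratedFDeriv_prod_le
    (contDiff_rescaledF hg hsupp l⁻¹ (l⁻¹ • zc κ)) l a b u η).trans ?_
  have hb : |l| ^ b = (1 + ‖zc κ‖ ^ 2) ^ ((b : ℝ) / 2) := by
    rw [abs_of_pos hl0, show l = √(1 + ‖zc κ‖ ^ 2) from rfl, Real.sqrt_eq_rpow, ← Real.rpow_mul_natCast (by positivity)]
    ring_nf
  rw [hb]
  gcongr
  have h := hC l⁻¹ (l⁻¹ • zc κ) ?_ ?_ (u, l • η)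
  · simpa only [smul_smul, inv_mul_cancel₀ hl0.ne', one_smul] using h
  · rw [abs_of_pos (inv_pos.2 hl0)]
    exact inv_le_one_of_one_le₀ hl1
  · rw [norm_smul, Real.norm_of_nonneg (inv_pos.2 hl0).le]
    exact (inv_mul_le_one₀ hl0).2 hκ
end
end

section
/- (Beals criterion) Let T : 𝒮(ℝ^d) → 𝒮'(ℝ^d) be continuous such that T and all iterated commutators with the operators W_k (W_k = X_k for 1 ≤ k ≤ d, W_k = D_{k-d} for d+1 ≤ k ≤ 2d) extend to bounded operators on L²(ℝ^d). Then there exists a symbol a_0 ∈ S⁰_{0,0}(ℝ^{2d}) such that for all Ψ, Φ ∈ 𝒮(ℝ^d), ⟨Ψ, TΦ⟩ = (2π)^{-d} ∫_{ℝ^d} ∫_{ℝ^{2d}} e^{iξ·(x-x')} conj(Ψ(x)) a_0((x+x')/2, ξ) Φ(x') dx dx' dξ, i.e. T is the Weyl quantization of a_0. -/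
noncomputable section
open MeasureTheory Real Complex

/-- The position operator `X_k` (multiplication by `x_k`). -/
def Xop {d : ℕ} (k : Fin d) (f : (Fin d → ℝ) → ℂ) : (Fin d → ℝ) → ℂ :=
  fun x => (x k : ℂ) * f x

/-- The momentum operator `D_k = -i ∂_k`. -/
def Dop {d : ℕ} (k : Fin d) (f : (Fin d → ℝ) → ℂ) : (Fin d → ℝ) → ℂ :=
  fun x => -Complex.I * fderiv ℝ f x (Pi.single k 1)

/-- `W_k`: position operators for the first `d` indices, momenta for the last `d`. -/
def Wop {d : ℕ} : Fin d ⊕ Fin d → ((Fin d → ℝ) → ℂ) → (Fin d → ℝ) → ℂ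
  | Sum.inl k => Xop k
  | Sum.inr k => Dop k

/-- Commutator of a sesquilinear form with a (formally self-adjoint) operator:
`⟨ψ, [W,T] φ⟩ = ⟨Wψ, Tφ⟩ - ⟨ψ, T(Wφ)⟩`. -/
def commForm {d : ℕ} (W : ((Fin d → ℝ) → ℂ) → (Fin d → ℝ) → ℂ)
    (Q : ((Fin d → ℝ) → ℂ) → ((Fin d → ℝ) → ℂ) → ℂ) :
    ((Fin d → ℝ) → ℂ) → ((Fin d → ℝ) → ℂ) → ℂ :=
  fun ψ φ => Q (W ψ) φ - Q ψ (W φ)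

/-- Iterated commutator form. -/
def commList {d : ℕ} (l : List (((Fin d → ℝ) → ℂ) → (Fin d → ℝ) → ℂ))
    (Q : ((Fin d → ℝ) → ℂ) → ((Fin d → ℝ) → ℂ) → ℂ) :
    ((Fin d → ℝ) → ℂ) → ((Fin d → ℝ) → ℂ) → ℂ :=
  l.foldr commForm Q

/-- The `L²` norm of a function on `ℝ^d`. -/
def l2norm {d : ℕ} (f : (Fin d → ℝ) → ℂ) : ℝ := Real.sqrt (∫ x, ‖f x‖ ^ 2)

namespace WeylBeals

open scoped SchwartzMap LineDeriv

/-- Phase space `ℝ^d × ℝ^d`, with coordinates (position, momentum). -/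
abbrev Phase (d : ℕ) := (Fin d → ℝ) × (Fin d → ℝ)

/-- Schwartz functions on `ℝ^d`. -/
abbrev Sch (d : ℕ) := 𝓢(Fin d → ℝ, ℂ)

variable {d : ℕ}

/-- The linear functional `x ↦ p · x`. -/
def dotL (p : Fin d → ℝ) : (Fin d → ℝ) →L[ℝ] ℝ :=
  ∑ i, p i • ContinuousLinearMap.proj (R := ℝ) (φ := fun _ : Fin d => ℝ) i

lemma dotL_apply (p x : Fin d → ℝ) : dotL p x = dotR p x := by
  simp [dotL, dotR]

lemma dotR_add_left (p q x : Fin d → ℝ) : dotR (p + q) x = dotR p x + dotR q x := by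
  simp [dotR, add_mul, Finset.sum_add_distrib]

lemma dotR_add_right (p x y : Fin d → ℝ) : dotR p (x + y) = dotR p x + dotR p y := by
  simp [dotR, mul_add, Finset.sum_add_distrib]

lemma dotR_smul_left (c : ℝ) (p x : Fin d → ℝ) : dotR (c • p) x = c * dotR p x := by
  simp [dotR, mul_assoc, Finset.mul_sum]

lemma dotR_neg_left (p x : Fin d → ℝ) : dotR (-p) x = -dotR p x := by
  simp [dotR]

lemma dotR_neg_right (p x : Fin d → ℝ) : dotR p (-x) = -dotR p x := by
  simp [dotR]

lemma dotR_zero_left (x : Fin d → ℝ) : dotR 0 x = 0 := by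
  simp [dotR]

lemma abs_dotR_le (p x : Fin d → ℝ) : |dotR p x| ≤ d * (‖p‖ * ‖x‖) := by
  calc |dotR p x| ≤ ∑ i, |p i * x i| := Finset.abs_sum_le_sum_abs _ _
    _ ≤ ∑ _i : Fin d, ‖p‖ * ‖x‖ := by
        refine Finset.sum_le_sum fun i _ => ?_
        rw [abs_mul]
        exact mul_le_mul (norm_le_pi_norm p i) (norm_le_pi_norm x i) (abs_nonneg _) (norm_nonneg _)
    _ = d * (‖p‖ * ‖x‖) := by simp

@[fun_prop]
lemma continuous_dotR {α : Type*} [TopologicalSpace α] {f g : α → Fin d → ℝ}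
    (hf : Continuous f) (hg : Continuous g) : Continuous fun a => dotR (f a) (g a) := by
  unfold dotR
  fun_prop

/-- The unimodular function `x ↦ e^{i p · x}`. -/
def chr (p x : Fin d → ℝ) : ℂ := cexp (I * (dotR p x : ℝ))

lemma norm_cexp_I_mul_ofReal (t : ℝ) : ‖cexp (I * (t : ℂ))‖ = 1 := by
  rw [mul_comm, Complex.norm_exp_ofReal_mul_I]

@[simp] lemma norm_chr (p x : Fin d → ℝ) : ‖chr p x‖ = 1 := norm_cexp_I_mul_ofReal _

lemma conj_chr (p x : Fin d → ℝ) : (starRingEnd ℂ) (chr p x) = chr (-p) x := by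
  simp [chr, ← Complex.exp_conj, dotR_neg_left]

lemma chr_add_left (p q x : Fin d → ℝ) : chr (p + q) x = chr p x * chr q x := by
  simp [chr, dotR_add_left, mul_add, Complex.exp_add]

lemma chr_add_right (p x y : Fin d → ℝ) : chr p (x + y) = chr p x * chr p y := by
  simp [chr, dotR_add_right, mul_add, Complex.exp_add]

lemma chr_neg_left (p x : Fin d → ℝ) : chr (-p) x = chr p (-x) := by
  simp [chr, dotR_neg_left, dotR_neg_right]

lemma chr_mul_chr_neg (p x : Fin d → ℝ) : chr p x * chr (-p) x = 1 := by
  rw [← chr_add_left]; simp [chr, dotR_zero_left]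

@[fun_prop]
lemma continuous_chr {α : Type*} [TopologicalSpace α] {f g : α → Fin d → ℝ}
    (hf : Continuous f) (hg : Continuous g) : Continuous fun a => chr (f a) (g a) := by
  unfold chr
  fun_prop

lemma hasTemperateGrowth_cexp_I : (fun t : ℝ => cexp (I * (t : ℂ))).HasTemperateGrowth := by
  have key : ∀ (c : ℂ) (n : ℕ), iteratedDeriv n (fun t : ℝ => c * cexp (I * (t : ℂ)))
      = fun t : ℝ => (I ^ n * c) * cexp (I * (t : ℂ)) := by
    intro c n
    induction n with
    | zero => simp
    | succ n ih =>
      rw [iteratedDeriv_succ, ih]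
      funext t
      have h : HasDerivAt (fun t : ℝ => I * (t : ℂ)) I t := by
        simpa using (Complex.ofRealCLM.hasDerivAt (x := t)).const_mul I
      rw [(h.cexp.const_mul (I ^ n * c)).deriv]
      ring
  refine ⟨?_, fun n => ⟨0, 1, fun t => ?_⟩⟩
  · exact (contDiff_const.mul Complex.ofRealCLM.contDiff).cexp
  · rw [norm_iteratedFDeriv_eq_norm_iteratedDeriv]
    have := congrFun (key 1 n) t
    simp only [one_mul] at this
    rw [this]
    simp

lemma hasTemperateGrowth_chr (p : Fin d → ℝ) : (chr p).HasTemperateGrowth := by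
  have := hasTemperateGrowth_cexp_I.comp (dotL p).hasTemperateGrowth
  simp only [Function.comp_def, dotL_apply] at this
  exact this

/-- The phase space shift `f ↦ e^{i p · x} f(x - q)`, where `z = (q, p)`. -/
def rho (z : Phase d) : Sch d →L[ℂ] Sch d :=
  (SchwartzMap.smulLeftCLM ℂ (chr z.2)).comp (SchwartzMap.compSubConstCLM ℂ z.1)

lemma rho_apply (z : Phase d) (f : Sch d) (x : Fin d → ℝ) :
    rho z f x = chr z.2 x * f (x - z.1) := by
  simp [rho, SchwartzMap.smulLeftCLM_apply_apply (hasTemperateGrowth_chr z.2)]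

/-- The parity operator `f ↦ f(-x)`. -/
def par : Sch d →L[ℂ] Sch d :=
  SchwartzMap.compCLMOfContinuousLinearEquiv ℂ (ContinuousLinearEquiv.neg ℝ)

lemma par_apply (f : Sch d) (x : Fin d → ℝ) : par f x = f (-x) := by
  simp [par]

lemma rho_rho (z w : Phase d) (f : Sch d) :
    rho z (rho w f) = chr (-w.2) z.1 • rho (z + w) f := by
  ext x
  simp only [rho_apply, smul_apply, smul_eq_mul, Prod.snd_add, Prod.fst_add]
  rw [sub_eq_add_neg x z.1, chr_add_right, chr_add_left, chr_neg_left,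
    show x + -z.1 - w.1 = x - (z.1 + w.1) by abel]
  ring

lemma rho_add (z w : Phase d) (f : Sch d) :
    rho (z + w) f = chr w.2 z.1 • rho z (rho w f) := by
  rw [rho_rho, smul_smul, chr_mul_chr_neg, one_smul]

lemma par_rho (z : Phase d) (f : Sch d) : par (rho z f) = rho (-z) (par f) := by
  ext x
  simp only [rho_apply, par_apply, Prod.snd_neg, Prod.fst_neg, chr_neg_left]
  congr 2
  abel

lemma rho_zero (f : Sch d) : rho 0 f = f := by
  ext x
  simp [rho_apply, chr, dotR_zero_left]

/-- The operators `W_k` on Schwartz space. -/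
def wop : Fin d ⊕ Fin d → Sch d →L[ℂ] Sch d
  | Sum.inl k => SchwartzMap.smulLeftCLM ℂ (fun x : Fin d → ℝ => (x k : ℂ))
  | Sum.inr k => (-I) • LineDeriv.lineDerivOpCLM ℂ (Sch d) (Pi.single k (1 : ℝ) : Fin d → ℝ)

lemma hasTemperateGrowth_coord (k : Fin d) :
    (fun x : Fin d → ℝ => (x k : ℂ)).HasTemperateGrowth :=
  (Complex.ofRealCLM.comp
    (ContinuousLinearMap.proj (R := ℝ) (φ := fun _ : Fin d => ℝ) k)).hasTemperateGrowth

lemma wop_inl_apply (k : Fin d) (f : Sch d) (x : Fin d → ℝ) :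
    wop (Sum.inl k) f x = x k * f x := by
  simp [wop, SchwartzMap.smulLeftCLM_apply_apply (hasTemperateGrowth_coord k)]

lemma wop_inr_apply (k : Fin d) (f : Sch d) (x : Fin d → ℝ) :
    wop (Sum.inr k) f x = -I * fderiv ℝ f x (Pi.single k 1) := by
  simp [wop, SchwartzMap.lineDerivOp_apply_eq_fderiv]

lemma coe_wop (k : Fin d ⊕ Fin d) (f : Sch d) : (⇑(wop k f) : (Fin d → ℝ) → ℂ) = Wop k f := by
  funext x
  cases k with
  | inl k => rw [wop_inl_apply]; rfl
  | inr k => rw [wop_inr_apply]; rfl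

/-- Phase space coordinates, indexed like the operators `W_k`. -/
def coord : Fin d ⊕ Fin d → Phase d →L[ℝ] ℝ
  | Sum.inl k => (ContinuousLinearMap.proj (R := ℝ) (φ := fun _ : Fin d => ℝ) k).comp
      (ContinuousLinearMap.fst ℝ _ _)
  | Sum.inr k => (ContinuousLinearMap.proj (R := ℝ) (φ := fun _ : Fin d => ℝ) k).comp
      (ContinuousLinearMap.snd ℝ _ _)

@[simp] lemma coord_inl (k : Fin d) (z : Phase d) : coord (Sum.inl k) z = z.1 k := rfl
@[simp] lemma coord_inr (k : Fin d) (z : Phase d) : coord (Sum.inr k) z = z.2 k := rfl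

lemma abs_coord_le (k : Fin d ⊕ Fin d) (z : Phase d) : |coord k z| ≤ ‖z‖ := by
  cases k with
  | inl k => exact (norm_le_pi_norm z.1 k).trans (norm_fst_le z)
  | inr k => exact (norm_le_pi_norm z.2 k).trans (norm_snd_le z)

lemma norm_le_sum_coord (z : Phase d) : ‖z‖ ≤ ∑ k, |coord k z| := by
  have h : ∀ k, |coord k z| ≤ ∑ k, |coord k z| := fun k =>
    Finset.single_le_sum (f := fun k => |coord k z|) (fun _ _ => abs_nonneg _) (Finset.mem_univ k)
  have h0 : 0 ≤ ∑ k, |coord k z| := Finset.sum_nonneg fun _ _ => abs_nonneg _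
  rw [Prod.norm_def]
  exact max_le ((pi_norm_le_iff_of_nonneg h0).2 fun k => h (Sum.inl k))
    ((pi_norm_le_iff_of_nonneg h0).2 fun k => h (Sum.inr k))

lemma hasFDerivAt_chr (p x : Fin d → ℝ) :
    HasFDerivAt (chr p) ((dotL p).smulRight (I * chr p x)) x := by
  have h1 : HasFDerivAt (fun x : Fin d → ℝ => ((dotL p x : ℝ) : ℂ))
      (Complex.ofRealCLM.comp (dotL p)) x :=
    Complex.ofRealCLM.hasFDerivAt.comp x (dotL p).hasFDerivAt
  have h2 := (h1.const_mul I).cexp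
  simp only [dotL_apply] at h2
  refine h2.congr_fderiv ?_
  ext v
  simp [chr, dotL_apply]
  ring

lemma wop_rho (k : Fin d ⊕ Fin d) (z : Phase d) (f : Sch d) :
    wop k (rho z f) = (coord k z : ℂ) • rho z f + rho z (wop k f) := by
  ext x
  cases k with
  | inl k =>
    simp only [wop_inl_apply, rho_apply, add_apply, smul_apply, coord_inl,
      smul_eq_mul, Pi.sub_apply]
    push_cast
    ring
  | inr k =>
    have h1 : HasFDerivAt (fun x => f (x - z.1)) (fderiv ℝ f (x - z.1)) x := by
      simpa [Function.comp_def] using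
        (f.hasFDerivAt (x - z.1)).comp x ((hasFDerivAt_id x).sub_const z.1)
    have h2 : HasFDerivAt (fun x => chr z.2 x * f (x - z.1)) _ x := (hasFDerivAt_chr z.2 x).mul h1
    have h3 : (⇑(rho z f) : (Fin d → ℝ) → ℂ) = fun x => chr z.2 x * f (x - z.1) := by
      funext x; exact rho_apply z f x
    have h4 : dotR z.2 (Pi.single k 1) = z.2 k := by simp [dotR, Pi.single_apply]
    rw [wop_inr_apply, h3]
    rw [h2.fderiv]
    simp only [rho_apply, add_apply, smul_apply, coord_inr,
      smul_eq_mul, wop_inr_apply, ContinuousLinearMap.smulRight_apply, dotL_apply, h4, real_smul]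
    linear_combination (-chr z.2 x * f (x - z.1) * z.2 k) * I_sq

/-- The `L²` norm of a Schwartz function. -/
def nm (a : Sch d) : ℝ := ‖SchwartzMap.toLpCLM ℂ ℂ 2 volume a‖

lemma nm_eq_l2norm (a : Sch d) : nm a = l2norm (fun x => a x) := by
  rw [nm, SchwartzMap.toLpCLM_apply, SchwartzMap.norm_toLp' (by simp) (by simp), l2norm,
    Real.sqrt_eq_rpow]
  simp

lemma nm_nonneg (a : Sch d) : 0 ≤ nm a := norm_nonneg _

lemma nm_add_le (a b : Sch d) : nm (a + b) ≤ nm a + nm b := by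
  simpa [nm, map_add] using norm_add_le (SchwartzMap.toLpCLM ℂ ℂ 2 volume a)
    (SchwartzMap.toLpCLM ℂ ℂ 2 volume b)

lemma nm_smul (c : ℂ) (a : Sch d) : nm (c • a) = ‖c‖ * nm a := by
  rw [nm, map_smul, norm_smul, nm]

lemma nm_sum_le {ι : Type*} (s : Finset ι) (a : ι → Sch d) :
    nm (∑ i ∈ s, a i) ≤ ∑ i ∈ s, nm (a i) := by
  simp only [nm, map_sum]
  exact norm_sum_le _ _

lemma nm_rho (z : Phase d) (a : Sch d) : nm (rho z a) = nm a := by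
  simp only [nm_eq_l2norm, l2norm, rho_apply, norm_mul, norm_chr, one_mul]
  rw [integral_sub_right_eq_self (fun x => ‖a x‖ ^ 2) z.1]

/-- Sesquilinear forms on Schwartz space. -/
abbrev Form (d : ℕ) := Sch d →ₗ⋆[ℂ] Sch d →ₗ[ℂ] ℂ

/-- The commutator of a form with `W_k`. -/
def comm (k : Fin d ⊕ Fin d) (B : Form d) : Form d :=
  LinearMap.mk₂'ₛₗ (starRingEnd ℂ) (RingHom.id ℂ)
    (fun a b => B (wop k a) b - B a (wop k b))
    (fun a a' b => by simp; ring) (fun c a b => by simp; ring)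
    (fun a b b' => by simp; ring) (fun c a b => by simp; ring)

lemma comm_apply (k : Fin d ⊕ Fin d) (B : Form d) (a b : Sch d) :
    comm k B a b = B (wop k a) b - B a (wop k b) := rfl

/-- All iterated commutators of the form with the `W_k` are `L²`-bounded. -/
def Beals (B : Form d) : Prop :=
  ∀ l : List (Fin d ⊕ Fin d), ∃ C, ∀ a b, ‖l.foldr comm B a b‖ ≤ C * nm a * nm b

lemma Beals.comm {B : Form d} (hB : Beals B) (k : Fin d ⊕ Fin d) : Beals (comm k B) := by
  intro l
  simpa using hB (l ++ [k])

lemma Beals.bound {B : Form d} (hB : Beals B) :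
    ∃ C, 0 ≤ C ∧ ∀ a b, ‖B a b‖ ≤ C * nm a * nm b := by
  obtain ⟨C, hC⟩ := hB []
  refine ⟨|C|, abs_nonneg C, fun a b => (hC a b).trans ?_⟩
  have := nm_nonneg a
  have := nm_nonneg b
  gcongr
  exact le_abs_self C

/-- Off-diagonal decay of a Beals form with respect to phase space shifts. -/
theorem Beals.decay (N : ℕ) : ∀ {B : Form d}, Beals B → ∀ a b : Sch d,
    ∃ C, 0 ≤ C ∧ ∀ z w, (1 + ‖z - w‖) ^ N * ‖B (rho z a) (rho w b)‖ ≤ C := by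
  induction N with
  | zero =>
    intro B hB a b
    obtain ⟨C, hC0, hC⟩ := hB.bound
    refine ⟨C * nm a * nm b, ?_, fun z w => ?_⟩
    · have := nm_nonneg a
      have := nm_nonneg b
      positivity
    · simpa [nm_rho] using hC (rho z a) (rho w b)
  | succ N ih =>
    intro B hB a b
    obtain ⟨C, hC0, hC⟩ := ih hB a b
    choose C₁ hC₁0 hC₁ using fun k => ih (hB.comm k) a b
    choose C₂ hC₂0 hC₂ using fun k => ih hB (wop k a) b
    choose C₃ hC₃0 hC₃ using fun k => ih hB a (wop k b)
    refine ⟨C + ∑ k, (C₁ k + C₂ k + C₃ k), ?_, fun z w => ?_⟩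
    · exact add_nonneg hC0 (Finset.sum_nonneg fun k _ =>
        add_nonneg (add_nonneg (hC₁0 k) (hC₂0 k)) (hC₃0 k))
    have key : ∀ k, (1 + ‖z - w‖) ^ N * (|coord k (z - w)| * ‖B (rho z a) (rho w b)‖)
        ≤ C₁ k + C₂ k + C₃ k := by
      intro k
      have e : (coord k (z - w) : ℂ) * B (rho z a) (rho w b) = WeylBeals.comm k B (rho z a) (rho w b)
          - B (rho z (wop k a)) (rho w b) + B (rho z a) (rho w (wop k b)) := by
        simp only [comm_apply, wop_rho, map_add, LinearMap.add_apply, map_smulₛₗ,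
          LinearMap.smul_apply, conj_ofReal, smul_eq_mul, map_sub, ofReal_sub, RingHom.id_apply]
        ring
      have e2 : |coord k (z - w)| * ‖B (rho z a) (rho w b)‖
          ≤ ‖WeylBeals.comm k B (rho z a) (rho w b)‖ + ‖B (rho z (wop k a)) (rho w b)‖
            + ‖B (rho z a) (rho w (wop k b))‖ := by
        have : |coord k (z - w)| = ‖(coord k (z - w) : ℂ)‖ := by
          rw [Complex.norm_real, Real.norm_eq_abs]
        rw [this, ← norm_mul, e]
        exact (norm_add_le _ _).trans (add_le_add_left (norm_sub_le _ _) _)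
      have e3 : 0 ≤ (1 + ‖z - w‖) ^ N := by positivity
      have := mul_le_mul_of_nonneg_left e2 e3
      linarith [hC₁ k z w, hC₂ k z w, hC₃ k z w]
    have h1 : (1 + ‖z - w‖) ^ (N + 1) * ‖B (rho z a) (rho w b)‖
        = (1 + ‖z - w‖) ^ N * ‖B (rho z a) (rho w b)‖
          + ‖z - w‖ * ((1 + ‖z - w‖) ^ N * ‖B (rho z a) (rho w b)‖) := by ring
    have h2 : ‖z - w‖ * ((1 + ‖z - w‖) ^ N * ‖B (rho z a) (rho w b)‖)
        ≤ ∑ k, (C₁ k + C₂ k + C₃ k) := by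
      calc _ ≤ (∑ k, |coord k (z - w)|) * ((1 + ‖z - w‖) ^ N * ‖B (rho z a) (rho w b)‖) := by
            gcongr
            exact norm_le_sum_coord _
        _ = ∑ k, (1 + ‖z - w‖) ^ N * (|coord k (z - w)| * ‖B (rho z a) (rho w b)‖) := by
            rw [Finset.sum_mul]
            exact Finset.sum_congr rfl fun k _ => by ring
        _ ≤ _ := Finset.sum_le_sum fun k _ => key k
    rw [h1]
    linarith [hC z w]

/-- Complex conjugation on Schwartz space. -/
def conjS : Sch d →L[ℝ] Sch d :=
  SchwartzMap.postcompCLM (𝕜 := ℝ) (Complex.conjCLE : ℂ →L[ℝ] ℂ)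

lemma conjS_apply (a : Sch d) (x : Fin d → ℝ) : conjS a x = (starRingEnd ℂ) (a x) := by
  simp [conjS]

/-- The `L²` inner product as a form on Schwartz space. -/
def sip : Form d :=
  LinearMap.mk₂'ₛₗ (starRingEnd ℂ) (RingHom.id ℂ)
    (fun a b => inner ℂ (SchwartzMap.toLpCLM ℂ ℂ 2 volume a) (SchwartzMap.toLpCLM ℂ ℂ 2 volume b))
    (fun a a' b => by simp [-SchwartzMap.toLpCLM_apply, inner_add_left])
    (fun c a b => by rw [map_smul, inner_smul_left]; rfl)
    (fun a b b' => by simp [-SchwartzMap.toLpCLM_apply, inner_add_right])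
    (fun c a b => by rw [map_smul, inner_smul_right]; rfl)

lemma sip_eq_inner (a b : Sch d) : sip a b =
    inner ℂ (SchwartzMap.toLpCLM ℂ ℂ 2 volume a) (SchwartzMap.toLpCLM ℂ ℂ 2 volume b) := rfl

lemma sip_apply (a b : Sch d) : sip a b = ∫ x, (starRingEnd ℂ) (a x) * b x := by
  rw [sip_eq_inner]
  refine (SchwartzMap.inner_toL2_toL2_eq a b volume).trans ?_
  simp [RCLike.inner_apply, mul_comm]

lemma norm_sip_le (a b : Sch d) : ‖sip a b‖ ≤ nm a * nm b := by
  rw [sip_eq_inner]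
  exact norm_inner_le_norm _ _

lemma sip_self (a : Sch d) : sip a a = (nm a : ℂ) ^ 2 := by
  rw [sip_eq_inner, inner_self_eq_norm_sq_to_K]
  rfl

lemma conj_sip (a b : Sch d) : (starRingEnd ℂ) (sip a b) = sip b a := by
  simp only [sip_eq_inner, inner_conj_symm]

lemma comm_sip (k : Fin d ⊕ Fin d) : comm k (sip : Form d) = 0 := by
  refine LinearMap.ext fun a => LinearMap.ext fun b => ?_
  simp only [comm_apply, sip_apply, LinearMap.zero_apply, sub_eq_zero]
  cases k with
  | inl k =>
    congr 1
    funext x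
    simp only [wop_inl_apply, map_mul, conj_ofReal]
    ring
  | inr k =>
    have h := SchwartzMap.integral_mul_lineDerivOp_right_eq_neg_left (μ := volume) (conjS a) b
      (Pi.single k 1)
    have h2 : ∀ x, fderiv ℝ (conjS a) x (Pi.single k 1)
        = (starRingEnd ℂ) (fderiv ℝ a x (Pi.single k 1)) := by
      intro x
      have h3 : HasFDerivAt (⇑(conjS a) : (Fin d → ℝ) → ℂ)
          ((Complex.conjCLE : ℂ →L[ℝ] ℂ).comp (fderiv ℝ a x)) x := by
        have := (Complex.conjCLE : ℂ →L[ℝ] ℂ).hasFDerivAt.comp x (a.hasFDerivAt x)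
        refine this.congr_of_eventuallyEq (Filter.Eventually.of_forall fun y => ?_)
        simp [conjS_apply]
      rw [h3.fderiv]
      simp
    simp only [SchwartzMap.lineDerivOp_apply_eq_fderiv, conjS_apply, h2] at h
    simp only [wop_inr_apply, map_mul, map_neg, conj_I, neg_neg]
    calc ∫ x, I * (starRingEnd ℂ) (fderiv ℝ a x (Pi.single k 1)) * b x
        = I * ∫ x, (starRingEnd ℂ) (fderiv ℝ a x (Pi.single k 1)) * b x := by
          rw [← integral_const_mul]; simp only [mul_assoc]
      _ = -I * ∫ x, (starRingEnd ℂ) (a x) * fderiv ℝ b x (Pi.single k 1) := by rw [h]; ring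
      _ = _ := by
          rw [← integral_const_mul]
          congr 1
          funext x
          ring

lemma beals_sip : Beals (sip : Form d) := by
  have h0 : ∀ l : List (Fin d ⊕ Fin d), l.foldr comm (0 : Form d) = 0 := by
    intro l
    induction l with
    | nil => rfl
    | cons k l ih =>
      rw [List.foldr_cons, ih]
      refine LinearMap.ext fun a => LinearMap.ext fun b => ?_
      simp [comm_apply]
  intro l
  rcases List.eq_nil_or_concat l with rfl | ⟨l', k, rfl⟩
  · exact ⟨1, fun a b => by simpa using norm_sip_le a b⟩
  · refine ⟨0, fun a b => ?_⟩
    simp [comm_sip, h0]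

lemma integrable_weight {E : Type*} [NormedAddCommGroup E] [NormedSpace ℝ E]
    [FiniteDimensional ℝ E] [MeasurableSpace E] [BorelSpace E] (μ : Measure E)
    [μ.IsAddHaarMeasure] {n : ℕ} (hn : Module.finrank ℝ E < n) :
    Integrable (fun x : E => ((1 + ‖x‖) ^ n)⁻¹) μ := by
  have := integrable_one_add_norm (μ := μ) (E := E) (r := n) (by exact_mod_cast hn)
  refine this.congr (Filter.Eventually.of_forall fun x => ?_)
  simp only
  rw [Real.rpow_neg (by positivity), Real.rpow_natCast]

lemma finrank_phase : Module.finrank ℝ (Phase d) = 2 * d := by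
  simp; ring

lemma exists_nm_le : ∃ K, 0 ≤ K ∧ ∀ (a : Sch d) (M : ℝ), 0 ≤ M →
    (∀ x, ‖a x‖ ≤ M * ((1 + ‖x‖) ^ (d + 1))⁻¹) → nm a ≤ K * M := by
  refine ⟨Real.sqrt (∫ x : Fin d → ℝ, ((1 + ‖x‖) ^ (2 * (d + 1)))⁻¹), Real.sqrt_nonneg _,
    fun a M hM h => ?_⟩
  have hi : Integrable (fun x : Fin d → ℝ => ((1 + ‖x‖) ^ (2 * (d + 1)))⁻¹) :=
    integrable_weight volume (by simp; omega)
  rw [nm_eq_l2norm, l2norm, ← Real.sqrt_sq hM, ← Real.sqrt_mul (integral_nonneg fun x => by positivity)]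
  refine Real.sqrt_le_sqrt ?_
  rw [mul_comm, ← integral_const_mul]
  refine integral_mono_of_nonneg (Filter.Eventually.of_forall fun x => by positivity)
    (hi.const_mul _) (Filter.Eventually.of_forall fun x => ?_)
  simp only
  calc ‖a x‖ ^ 2 ≤ (M * ((1 + ‖x‖) ^ (d + 1))⁻¹) ^ 2 := by
        gcongr
        exact h x
    _ = _ := by rw [mul_pow, inv_pow, ← pow_mul, mul_comm (d + 1)]

lemma exists_decay {F : Type*} [NormedAddCommGroup F] [NormedSpace ℝ F]
    (f : 𝓢(Fin d → ℝ, F)) (n : ℕ) :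
    ∃ C, 0 ≤ C ∧ ∀ x, (1 + ‖x‖) ^ n * ‖f x‖ ≤ C := by
  refine ⟨2 ^ n * (Finset.Iic (n, 0)).sup (fun m => SchwartzMap.seminorm ℝ m.1 m.2) f,
    by positivity, fun x => ?_⟩
  have := SchwartzMap.one_add_le_sup_seminorm_apply (𝕜 := ℝ) (m := (n, 0)) le_rfl le_rfl f x
  simpa using this

/-- `gen z` is the derivative of `t ↦ rho (t z)` at `0`. -/
def gen (z : Phase d) (f : Sch d) : Sch d :=
  (∑ k : Fin d, (I * coord (Sum.inr k) z) • wop (Sum.inl k) f)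
    + ∑ k : Fin d, (-I * coord (Sum.inl k) z) • wop (Sum.inr k) f

lemma gen_apply (z : Phase d) (f : Sch d) (x : Fin d → ℝ) :
    gen z f x = I * (dotR z.2 x : ℝ) * f x - fderiv ℝ f x z.1 := by
  have h1 : fderiv ℝ f x z.1 = ∑ k, (z.1 k : ℂ) * fderiv ℝ f x (Pi.single k 1) := by
    conv_lhs => rw [← Finset.univ_sum_single z.1]
    rw [map_sum]
    refine Finset.sum_congr rfl fun k _ => ?_
    have : (Pi.single k (z.1 k) : Fin d → ℝ) = z.1 k • Pi.single k 1 := by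
      rw [← Pi.single_smul]; simp
    rw [this, map_smul, real_smul]
  rw [gen, add_apply, h1, sum_apply, sum_apply, sub_eq_add_neg,
    ← Finset.sum_neg_distrib]
  congr 1
  · simp only [smul_apply, wop_inl_apply, coord_inr, smul_eq_mul, dotR, ofReal_sum, ofReal_mul,
      Finset.mul_sum, Finset.sum_mul]
    exact Finset.sum_congr rfl fun k _ => by ring
  · refine Finset.sum_congr rfl fun k _ => ?_
    simp only [smul_apply, wop_inr_apply, coord_inl, smul_eq_mul]
    linear_combination (z.1 k * fderiv ℝ f x (Pi.single k 1)) * I_sq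

lemma exists_nm_gen_le (f : Sch d) : ∃ C, 0 ≤ C ∧ ∀ z, nm (gen z f) ≤ C * ‖z‖ := by
  refine ⟨(∑ k : Fin d, nm (wop (Sum.inl k) f)) + ∑ k : Fin d, nm (wop (Sum.inr k) f),
    add_nonneg (Finset.sum_nonneg fun _ _ => nm_nonneg _) (Finset.sum_nonneg fun _ _ => nm_nonneg _),
    fun z => ?_⟩
  refine (nm_add_le _ _).trans ?_
  rw [add_mul, Finset.sum_mul, Finset.sum_mul]
  refine add_le_add ((nm_sum_le _ _).trans (Finset.sum_le_sum fun k _ => ?_))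
    ((nm_sum_le _ _).trans (Finset.sum_le_sum fun k _ => ?_))
  · rw [nm_smul, mul_comm]
    refine mul_le_mul_of_nonneg_left ?_ (nm_nonneg _)
    rw [norm_mul, norm_I, one_mul, Complex.norm_real]
    exact abs_coord_le _ z
  · rw [nm_smul, mul_comm]
    refine mul_le_mul_of_nonneg_left ?_ (nm_nonneg _)
    rw [norm_mul, norm_neg, norm_I, one_mul, Complex.norm_real]
    exact abs_coord_le _ z

lemma norm_cexp_I_sub_one_sub_le (t : ℝ) : ‖cexp (I * t) - 1 - I * t‖ ≤ 2 * t ^ 2 := by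
  have hn : ‖I * (t : ℂ)‖ = |t| := by simp
  rcases le_total |t| 1 with h | h
  · have := Complex.norm_exp_sub_one_sub_id_le (x := I * t) (by rw [hn]; exact h)
    rw [hn, sq_abs] at this
    nlinarith [sq_nonneg t]
  · have h1 := Real.norm_exp_I_mul_ofReal_sub_one_le (x := t)
    rw [Real.norm_eq_abs] at h1
    calc _ ≤ ‖cexp (I * t) - 1‖ + ‖I * (t : ℂ)‖ := norm_sub_le _ _
      _ ≤ |t| + |t| := by rw [hn]; gcongr
      _ ≤ 2 * t ^ 2 := by rw [← sq_abs t]; nlinarith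

lemma exists_taylor (f : Sch d) (n : ℕ) : ∃ C, 0 ≤ C ∧ ∀ m x : Fin d → ℝ, ‖m‖ ≤ 1 →
    (1 + ‖x‖) ^ n * ‖f (x - m) - f x + fderiv ℝ f x m‖ ≤ C * ‖m‖ ^ 2 := by
  let F := SchwartzMap.fderivCLM ℝ (Fin d → ℝ) ℂ f
  obtain ⟨C, hC0, hC⟩ := exists_decay (SchwartzMap.fderivCLM ℝ (Fin d → ℝ) _ F) n
  refine ⟨2 ^ n * C, by positivity, fun m x hm => ?_⟩
  have hpos : (0 : ℝ) < (1 + ‖x‖) ^ n := by positivity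
  have hb : ∀ y ∈ Metric.closedBall x ‖m‖, ‖fderiv ℝ F y‖ ≤ 2 ^ n * C / (1 + ‖x‖) ^ n := by
    intro y hy
    rw [mem_closedBall_iff_norm] at hy
    have h1 : 1 + ‖x‖ ≤ 2 * (1 + ‖y‖) := by
      have : ‖x‖ ≤ ‖y‖ + ‖y - x‖ := by
        simpa [norm_sub_rev] using norm_le_norm_add_norm_sub' x y
      linarith [norm_nonneg y]
    rw [le_div_iff₀ hpos]
    calc ‖fderiv ℝ F y‖ * (1 + ‖x‖) ^ n ≤ ‖fderiv ℝ F y‖ * (2 * (1 + ‖y‖)) ^ n := by gcongr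
      _ = 2 ^ n * ((1 + ‖y‖) ^ n * ‖fderiv ℝ F y‖) := by rw [mul_pow]; ring
      _ ≤ 2 ^ n * C := by gcongr; exact hC y
  have hx : x ∈ Metric.closedBall x ‖m‖ := Metric.mem_closedBall_self (norm_nonneg m)
  have hxm : x - m ∈ Metric.closedBall x ‖m‖ := by simp
  have h1 : ∀ y ∈ Metric.closedBall x ‖m‖,
      ‖fderiv ℝ f y - fderiv ℝ f x‖ ≤ 2 ^ n * C / (1 + ‖x‖) ^ n * ‖m‖ := by
    intro y hy
    have := (convex_closedBall x ‖m‖).norm_image_sub_le_of_norm_fderiv_le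
      (f := F) (𝕜 := ℝ) (fun y _ => F.differentiableAt) hb hx hy
    refine this.trans ?_
    gcongr
    rwa [mem_closedBall_iff_norm] at hy
  have h2 := (convex_closedBall x ‖m‖).norm_image_sub_le_of_norm_fderiv_le'
      (f := f) (𝕜 := ℝ) (φ := fderiv ℝ f x) (fun y _ => f.differentiableAt) h1 hx hxm
  have e : x - m - x = -m := by abel
  rw [e, map_neg, sub_neg_eq_add, norm_neg] at h2
  calc _ ≤ (1 + ‖x‖) ^ n * (2 ^ n * C / (1 + ‖x‖) ^ n * ‖m‖ * ‖m‖) := by gcongr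
    _ = _ := by field_simp

lemma exists_nm_rho_sub_sub_gen_le (f : Sch d) : ∃ C, 0 ≤ C ∧ ∀ z, ‖z‖ ≤ 1 →
    nm (rho z f - f - gen z f) ≤ C * ‖z‖ ^ 2 := by
  obtain ⟨K, hK0, hK⟩ := exists_nm_le (d := d)
  obtain ⟨C₁, hC₁0, hC₁⟩ := exists_taylor f (d + 1)
  obtain ⟨C₂, hC₂0, hC₂⟩ := exists_decay f (d + 3)
  obtain ⟨C₃, hC₃0, hC₃⟩ := exists_decay (SchwartzMap.fderivCLM ℝ (Fin d → ℝ) ℂ f) (d + 2)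
  refine ⟨K * (C₁ + 2 * d ^ 2 * C₂ + d * C₃), by positivity, fun z hz => ?_⟩
  rw [mul_assoc]
  refine hK _ _ (by positivity) fun x => ?_
  rw [← div_eq_mul_inv, le_div_iff₀ (by positivity)]
  have hz1 : ‖z.1‖ ≤ ‖z‖ := norm_fst_le z
  have hz2 : ‖z.2‖ ≤ ‖z‖ := norm_snd_le z
  have hdot : |dotR z.2 x| ≤ d * (‖z‖ * (1 + ‖x‖)) := (abs_dotR_le _ _).trans (by gcongr; linarith)
  have e : (rho z f - f - gen z f) x = chr z.2 x * (f (x - z.1) - f x + fderiv ℝ f x z.1)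
      + (cexp (I * (dotR z.2 x : ℝ)) - 1 - I * (dotR z.2 x : ℝ)) * f x
      - (cexp (I * (dotR z.2 x : ℝ)) - 1) * fderiv ℝ f x z.1 := by
    rw [sub_apply, sub_apply, rho_apply, gen_apply, chr]
    ring
  have t1 : ‖chr z.2 x * (f (x - z.1) - f x + fderiv ℝ f x z.1)‖ * (1 + ‖x‖) ^ (d + 1)
      ≤ C₁ * ‖z‖ ^ 2 := by
    rw [norm_mul, norm_chr, one_mul, mul_comm]
    exact (hC₁ z.1 x (hz1.trans hz)).trans (by gcongr)
  have t2 : ‖(cexp (I * (dotR z.2 x : ℝ)) - 1 - I * (dotR z.2 x : ℝ)) * f x‖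
      * (1 + ‖x‖) ^ (d + 1) ≤ 2 * d ^ 2 * C₂ * ‖z‖ ^ 2 := by
    rw [norm_mul]
    calc _ ≤ 2 * (d * (‖z‖ * (1 + ‖x‖))) ^ 2 * ‖f x‖ * (1 + ‖x‖) ^ (d + 1) := by
          gcongr
          refine (norm_cexp_I_sub_one_sub_le _).trans ?_
          rw [← sq_abs]
          gcongr
      _ = 2 * d ^ 2 * ((1 + ‖x‖) ^ (d + 3) * ‖f x‖) * ‖z‖ ^ 2 := by ring
      _ ≤ _ := by gcongr; exact hC₂ x
  have t3 : ‖(cexp (I * (dotR z.2 x : ℝ)) - 1) * fderiv ℝ f x z.1‖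
      * (1 + ‖x‖) ^ (d + 1) ≤ d * C₃ * ‖z‖ ^ 2 := by
    rw [norm_mul]
    calc _ ≤ (d * (‖z‖ * (1 + ‖x‖))) * (‖fderiv ℝ f x‖ * ‖z‖) * (1 + ‖x‖) ^ (d + 1) := by
          gcongr
          · exact (Real.norm_exp_I_mul_ofReal_sub_one_le (x := dotR z.2 x)).trans hdot
          · exact (ContinuousLinearMap.le_opNorm _ _).trans (by gcongr)
      _ = d * ((1 + ‖x‖) ^ (d + 2) * ‖fderiv ℝ f x‖) * ‖z‖ ^ 2 := by ring
      _ ≤ _ := by gcongr; exact hC₃ x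
  rw [e]
  calc _ ≤ (‖chr z.2 x * (f (x - z.1) - f x + fderiv ℝ f x z.1)‖
      + ‖(cexp (I * (dotR z.2 x : ℝ)) - 1 - I * (dotR z.2 x : ℝ)) * f x‖
      + ‖(cexp (I * (dotR z.2 x : ℝ)) - 1) * fderiv ℝ f x z.1‖) * (1 + ‖x‖) ^ (d + 1) := by
        gcongr
        exact (norm_sub_le _ _).trans (by gcongr; exact norm_add_le _ _)
    _ ≤ _ := by linarith

lemma exists_nm_rho_sub_le (f : Sch d) : ∃ C, 0 ≤ C ∧ ∀ z, ‖z‖ ≤ 1 →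
    nm (rho z f - f) ≤ C * ‖z‖ := by
  obtain ⟨C₁, h₁0, h₁⟩ := exists_nm_rho_sub_sub_gen_le f
  obtain ⟨C₂, h₂0, h₂⟩ := exists_nm_gen_le f
  refine ⟨C₁ + C₂, by positivity, fun z hz => ?_⟩
  have := nm_add_le (rho z f - f - gen z f) (gen z f)
  rw [sub_add_cancel] at this
  have h3 : ‖z‖ ^ 2 ≤ ‖z‖ := by nlinarith [norm_nonneg z]
  nlinarith [h₁ z hz, h₂ z]

open Filter Topology in
lemma tendsto_nm_rho_sub (f : Sch d) (z₀ : Phase d) :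
    Tendsto (fun z => nm (rho z f - rho z₀ f)) (𝓝 z₀) (𝓝 0) := by
  obtain ⟨C, hC0, hC⟩ := exists_nm_rho_sub_le (rho z₀ f)
  have hle : ∀ᶠ z in 𝓝 z₀, nm (rho z f - rho z₀ f)
      ≤ ‖chr z₀.2 (z - z₀).1 - 1‖ * nm f + C * ‖z - z₀‖ := by
    filter_upwards [Metric.closedBall_mem_nhds z₀ one_pos] with z hz
    rw [mem_closedBall_iff_norm] at hz
    have e : rho z f - rho z₀ f = (chr z₀.2 (z - z₀).1 - 1) • rho (z - z₀) (rho z₀ f)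
        + (rho (z - z₀) (rho z₀ f) - rho z₀ f) := by
      conv_lhs => rw [← sub_add_cancel z z₀, rho_add]
      rw [sub_smul, one_smul]
      abel
    rw [e]
    refine (nm_add_le _ _).trans (add_le_add ?_ (hC _ hz))
    rw [nm_smul, nm_rho, nm_rho]
  refine squeeze_zero' (Eventually.of_forall fun z => nm_nonneg _) hle ?_
  have hc : Continuous fun z : Phase d =>
      ‖chr z₀.2 (z - z₀).1 - 1‖ * nm f + C * ‖z - z₀‖ := by fun_prop
  have := hc.tendsto z₀
  simpa [chr, dotR] using this

lemma Beals.continuous {B : Form d} (hB : Beals B) (a b : Sch d) :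
    Continuous fun zw : Phase d × Phase d => B (rho zw.1 a) (rho zw.2 b) := by
  obtain ⟨C, hC0, hC⟩ := hB.bound
  rw [continuous_iff_continuousAt]
  rintro ⟨z₀, w₀⟩
  rw [ContinuousAt, tendsto_iff_norm_sub_tendsto_zero]
  have h1 := (tendsto_nm_rho_sub a z₀).comp (continuous_fst.tendsto (z₀, w₀))
  have h2 := (tendsto_nm_rho_sub b w₀).comp (continuous_snd.tendsto (z₀, w₀))
  have h3 := ((h1.const_mul C).mul_const (nm b)).add (h2.const_mul (C * nm a))
  simp only [mul_zero, zero_mul, add_zero] at h3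
  refine squeeze_zero (fun _ => norm_nonneg _) (fun zw => ?_) h3
  have e : B (rho zw.1 a) (rho zw.2 b) - B (rho z₀ a) (rho w₀ b)
      = B (rho zw.1 a - rho z₀ a) (rho zw.2 b) + B (rho z₀ a) (rho zw.2 b - rho w₀ b) := by
    simp only [map_sub, LinearMap.sub_apply]
    ring
  rw [e]
  refine (norm_add_le _ _).trans (add_le_add ((hC _ _).trans_eq ?_) ((hC _ _).trans_eq ?_))
  · simp [nm_rho]
  · simp [nm_rho]

lemma comm_smul (k : Fin d ⊕ Fin d) (c : ℂ) (B : Form d) : comm k (c • B) = c • comm k B := by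
  refine LinearMap.ext fun a => LinearMap.ext fun b => ?_
  simp only [comm_apply, LinearMap.smul_apply, smul_eq_mul]
  ring

lemma Beals.smul {B : Form d} (hB : Beals B) (c : ℂ) : Beals (c • B) := by
  intro l
  have h : l.foldr WeylBeals.comm (c • B) = c • l.foldr WeylBeals.comm B := by
    induction l with
    | nil => rfl
    | cons k l ih => rw [List.foldr_cons, ih, comm_smul, List.foldr_cons]
  obtain ⟨C, hC⟩ := hB l
  refine ⟨‖c‖ * C, fun a b => ?_⟩
  rw [h, LinearMap.smul_apply, LinearMap.smul_apply, norm_smul, mul_assoc, mul_assoc, ← mul_assoc C]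
  exact mul_le_mul_of_nonneg_left (hC a b) (norm_nonneg c)

/-- The form giving the derivative of `u ↦ B (rho u f) (rho u h)` in the direction of the
phase space coordinate `k`. -/
def ad (k : Fin d ⊕ Fin d) (B : Form d) : Form d :=
  match k with
  | Sum.inl j => I • comm (Sum.inr j) B
  | Sum.inr j => (-I) • comm (Sum.inl j) B

lemma Beals.ad {B : Form d} (hB : Beals B) (k : Fin d ⊕ Fin d) : Beals (ad k B) := by
  cases k with
  | inl j => exact (hB.comm _).smul _
  | inr j => exact (hB.comm _).smul _

lemma apply_gen (B : Form d) (v : Phase d) (f h : Sch d) :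
    B (gen v f) h + B f (gen v h) = ∑ k, (coord k v : ℂ) * ad k B f h := by
  simp only [gen, map_add, map_sum, LinearMap.add_apply, LinearMap.sum_apply, map_smulₛₗ,
    LinearMap.smul_apply, Fintype.sum_sum_type, ad, comm_apply, smul_eq_mul, map_mul, map_neg,
    conj_I, conj_ofReal, RingHom.id_apply]
  rw [add_add_add_comm, add_comm (∑ k : Fin d, (coord (Sum.inl k) v : ℂ) * _),
    ← Finset.sum_add_distrib, ← Finset.sum_add_distrib]
  congr 1
  · exact Finset.sum_congr rfl fun k _ => by ring
  · exact Finset.sum_congr rfl fun k _ => by ring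

lemma apply_rho_add (B : Form d) (u v : Phase d) (f h : Sch d) :
    B (rho (u + v) f) (rho (u + v) h) = B (rho v (rho u f)) (rho v (rho u h)) := by
  rw [add_comm u v, rho_add, rho_add]
  simp only [map_smulₛₗ, LinearMap.smul_apply, smul_eq_mul, RingHom.id_apply, conj_chr]
  rw [← mul_assoc, chr_mul_chr_neg, one_mul]

open Asymptotics Filter Topology in
lemma Beals.hasFDerivAt {B : Form d} (hB : Beals B) (f h : Sch d) (u : Phase d) :
    HasFDerivAt (fun u => B (rho u f) (rho u h))
      (∑ k, (coord k).smulRight (WeylBeals.ad k B (rho u f) (rho u h))) u := by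
  obtain ⟨C, hC0, hC⟩ := hB.bound
  generalize hF : rho u f = F
  generalize hH : rho u h = H
  obtain ⟨C₁, h₁0, h₁⟩ := exists_nm_rho_sub_sub_gen_le F
  obtain ⟨C₂, h₂0, h₂⟩ := exists_nm_rho_sub_sub_gen_le H
  obtain ⟨C₃, h₃0, h₃⟩ := exists_nm_gen_le F
  obtain ⟨C₄, h₄0, h₄⟩ := exists_nm_rho_sub_le H
  have nH := nm_nonneg H
  have nF := nm_nonneg F
  rw [hasFDerivAt_iff_isLittleO_nhds_zero]
  refine IsBigO.trans_isLittleO (IsBigO.of_bound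
    (C * C₁ * nm H + C * nm F * C₂ + C * C₃ * C₄) ?_) (isLittleO_norm_pow_id one_lt_two)
  filter_upwards [Metric.closedBall_mem_nhds (0 : Phase d) one_pos] with v hv
  rw [mem_closedBall_zero_iff] at hv
  rw [apply_rho_add, hF, hH]
  have e1 : (∑ k, (coord k).smulRight (WeylBeals.ad k B F H)) v
      = B (gen v F) H + B F (gen v H) := by
    rw [apply_gen, sum_apply]
    exact Finset.sum_congr rfl fun k _ => by
      rw [ContinuousLinearMap.smulRight_apply, real_smul]
  have e2 : B (rho v F) (rho v H) - B F H - (B (gen v F) H + B F (gen v H))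
      = B (rho v F - F - gen v F) (rho v H) + B F (rho v H - H - gen v H)
        + B (gen v F) (rho v H - H) := by
    simp only [map_sub, LinearMap.sub_apply]
    ring
  rw [e1, e2, norm_pow, norm_norm]
  calc _ ≤ C * (C₁ * ‖v‖ ^ 2) * nm H + C * nm F * (C₂ * ‖v‖ ^ 2)
        + C * (C₃ * ‖v‖) * (C₄ * ‖v‖) := by
        refine (norm_add₃_le).trans (add_le_add (add_le_add ?_ ?_) ?_)
        · refine (hC _ _).trans ?_
          rw [nm_rho]
          gcongr
          exact h₁ v hv
        · refine (hC _ _).trans ?_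
          gcongr
          exact h₂ v hv
        · have := nm_nonneg (rho v H - H)
          refine (hC _ _).trans ?_
          gcongr
          · exact h₃ v
          · exact h₄ v hv
    _ = _ := by ring

/-- The integrand defining the symbol of the form `B`, with window `g`. -/
def symK (g : Sch d) (B : Form d) (u v : Phase d) : ℂ :=
  B (rho u (rho v g)) (rho u (rho (-v) (par g)))

lemma symK_eq (g : Sch d) (B : Form d) (u v : Phase d) :
    symK g B u v = chr v.2 u.1 ^ 2 * B (rho (u + v) g) (rho (u - v) (par g)) := by
  rw [symK, rho_rho, rho_rho]
  simp only [map_smulₛₗ, LinearMap.smul_apply, smul_eq_mul, RingHom.id_apply, conj_chr,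
    Prod.snd_neg, neg_neg, ← sub_eq_add_neg]
  ring

lemma Beals.continuous_symK {B : Form d} (hB : Beals B) (g : Sch d) :
    Continuous fun uv : Phase d × Phase d => symK g B uv.1 uv.2 := by
  simp only [symK_eq]
  refine Continuous.mul (by fun_prop) ?_
  exact (hB.continuous g (par g)).comp
    (f := fun uv : Phase d × Phase d => (uv.1 + uv.2, uv.1 - uv.2)) (by fun_prop)

lemma Beals.norm_symK_le {B : Form d} (hB : Beals B) (g : Sch d) (n : ℕ) :
    ∃ C, 0 ≤ C ∧ ∀ u v, ‖symK g B u v‖ ≤ C * ((1 + ‖v‖) ^ n)⁻¹ := by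
  obtain ⟨C, hC0, hC⟩ := hB.decay n g (par g)
  refine ⟨C, hC0, fun u v => ?_⟩
  rw [symK_eq, norm_mul, norm_pow, norm_chr, one_pow, one_mul, ← div_eq_mul_inv,
    le_div_iff₀ (by positivity), mul_comm]
  refine le_trans ?_ (hC (u + v) (u - v))
  have : u + v - (u - v) = (2 : ℝ) • v := by rw [two_smul]; abel
  rw [this, norm_smul, Real.norm_ofNat]
  gcongr
  linarith [norm_nonneg v]

/-- The Weyl symbol of the form `B`, up to normalization, with window `g`. -/
def sym (g : Sch d) (B : Form d) (u : Phase d) : ℂ := ∫ v, symK g B u v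

instance : (volume : Measure (Phase d)).IsAddHaarMeasure :=
  Measure.prod.instIsAddHaarMeasure volume volume

lemma integrable_phase_weight :
    Integrable (fun v : Phase d => ((1 + ‖v‖) ^ (2 * d + 1))⁻¹) :=
  integrable_weight volume (by rw [finrank_phase]; omega)

lemma Beals.integrable_symK {B : Form d} (hB : Beals B) (g : Sch d) (u : Phase d) :
    Integrable (symK g B u) := by
  obtain ⟨C, hC0, hC⟩ := hB.norm_symK_le g (2 * d + 1)
  refine (integrable_phase_weight.const_mul C).mono' ?_ (Filter.Eventually.of_forall (hC u))
  exact ((hB.continuous_symK g).comp (Continuous.prodMk_right u)).aestronglyMeasurable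

lemma Beals.hasFDerivAt_sym {B : Form d} (hB : Beals B) (g : Sch d) (u : Phase d) :
    HasFDerivAt (sym g B)
      (∑ k, ContinuousLinearMap.smulRightL ℝ (Phase d) ℂ (coord k)
        (sym g (WeylBeals.ad k B) u)) u := by
  choose C hC0 hC using fun k => (hB.ad k).norm_symK_le g (2 * d + 1)
  have hi : ∀ k u, Integrable (symK g (WeylBeals.ad k B) u) := fun k => (hB.ad k).integrable_symK g
  let L := fun k => ContinuousLinearMap.smulRightL ℝ (Phase d) ℂ (coord k)
  have key := hasFDerivAt_integral_of_dominated_of_fderiv_le (𝕜 := ℝ) (μ := volume)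
    (F := fun u v => symK g B u v) (x₀ := u)
    (F' := fun u v => ∑ k, L k (symK g (WeylBeals.ad k B) u v))
    (bound := fun v => ∑ k, ‖L k‖ * (C k * ((1 + ‖v‖) ^ (2 * d + 1))⁻¹))
    Filter.univ_mem
    (Filter.Eventually.of_forall fun u => (hB.integrable_symK g u).aestronglyMeasurable)
    (hB.integrable_symK g u)
    (integrable_finsetSum _ fun k _ => (L k).integrable_comp (hi k u)).aestronglyMeasurable
    (Filter.Eventually.of_forall fun v u _ => norm_sum_le_of_le _ fun k _ =>
      ((L k).le_opNorm _).trans (mul_le_mul_of_nonneg_left (hC k u v) (norm_nonneg _)))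
    (integrable_finsetSum _ fun k _ => (integrable_phase_weight.const_mul _).const_mul _)
    (Filter.Eventually.of_forall fun v u _ => hB.hasFDerivAt _ _ u)
  refine key.congr_fderiv ?_
  rw [integral_finsetSum _ fun k _ => (L k).integrable_comp (hi k u)]
  exact Finset.sum_congr rfl fun k _ => (L k).integral_comp_comm (hi k u)

lemma Beals.contDiff_sym (g : Sch d) (n : ℕ) : ∀ {B : Form d}, Beals B →
    ContDiff ℝ n (sym g B) := by
  induction n with
  | zero =>
    intro B hB
    exact contDiff_zero.2 (continuous_iff_continuousAt.2 fun u => (hB.hasFDerivAt_sym g u).continuousAt)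
  | succ n ih =>
    intro B hB
    exact contDiff_succ_iff_hasFDerivAt.2 ⟨_, ContDiff.sum fun k _ =>
      (ContinuousLinearMap.smulRightL ℝ (Phase d) ℂ (coord k)).contDiff.comp (ih (hB.ad k)),
      hB.hasFDerivAt_sym g⟩

lemma Beals.norm_iteratedFDeriv_sym_le (g : Sch d) (n : ℕ) : ∀ {B : Form d}, Beals B →
    ∃ C, ∀ u, ‖iteratedFDeriv ℝ n (sym g B) u‖ ≤ C := by
  induction n with
  | zero =>
    intro B hB
    obtain ⟨C, hC0, hC⟩ := hB.norm_symK_le g (2 * d + 1)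
    refine ⟨∫ v : Phase d, C * ((1 + ‖v‖) ^ (2 * d + 1))⁻¹, fun u => ?_⟩
    rw [norm_iteratedFDeriv_zero]
    exact norm_integral_le_of_norm_le (integrable_phase_weight.const_mul C)
      (Filter.Eventually.of_forall (hC u))
  | succ n ih =>
    intro B hB
    choose C hC using fun k => ih (hB.ad k)
    let L := fun k => ContinuousLinearMap.smulRightL ℝ (Phase d) ℂ (coord k)
    have hs : ∀ k, ContDiff ℝ n (sym g (WeylBeals.ad k B)) := fun k =>
      Beals.contDiff_sym g n (hB.ad k)
    refine ⟨∑ k, ‖L k‖ * C k, fun u => ?_⟩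
    have e : fderiv ℝ (sym g B) = fun u => ∑ k, (L k ∘ sym g (WeylBeals.ad k B)) u :=
      funext fun u => (hB.hasFDerivAt_sym g u).fderiv
    rw [← norm_iteratedFDeriv_fderiv, e, iteratedFDeriv_fun_sum_apply fun k _ =>
      ((L k).contDiff.comp (hs k)).contDiffAt]
    exact norm_sum_le_of_le _ fun k _ =>
      ((L k).norm_iteratedFDeriv_comp_left (hs k).contDiffAt le_rfl).trans
        (mul_le_mul_of_nonneg_left (hC k u) (norm_nonneg _))

lemma dotR_comm (x y : Fin d → ℝ) : dotR x y = dotR y x := by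
  simp only [dotR, mul_comm]

open scoped FourierTransform in
/-- Fourier inversion. -/
lemma integral_chr_mul_integral (h : Sch d) (x : Fin d → ℝ) :
    ∫ p, chr p x * ∫ y, chr (-p) y * h y = ((2 * π : ℝ) ^ d : ℝ) * h x := by
  let h' : 𝓢(EuclideanSpace ℝ (Fin d), ℂ) :=
    SchwartzMap.compCLMOfContinuousLinearEquiv ℂ (PiLp.continuousLinearEquiv 2 ℝ (fun _ : Fin d => ℝ)) h
  have hcoe : ∀ y : Fin d → ℝ, h' (WithLp.toLp 2 y) = h y := fun y => rfl
  have hv := PiLp.volume_preserving_toLp (Fin d)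
  have hint : ∀ F : EuclideanSpace ℝ (Fin d) → ℂ, ∫ y : Fin d → ℝ, F (WithLp.toLp 2 y) = ∫ v, F v :=
    fun F => hv.integral_comp (MeasurableEquiv.toLp 2 (Fin d → ℝ)).measurableEmbedding F
  have hin : ∀ v w : Fin d → ℝ, inner ℝ (WithLp.toLp 2 v) (WithLp.toLp 2 w) = dotR w v := by
    intro v w
    simp [PiLp.inner_apply, dotR]
  have h0 : 𝓕⁻ (𝓕 (h' : EuclideanSpace ℝ (Fin d) → ℂ)) (WithLp.toLp 2 x) = h' (WithLp.toLp 2 x) := by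
    rw [h'.continuous.fourierInv_fourier_eq h'.integrable (𝓕 h').integrable]
  rw [Real.fourierInv_eq', ← hint] at h0
  simp only [Real.fourier_eq', ← hint, hin, hcoe, smul_eq_mul] at h0
  rw [← h0]
  have hs := Measure.integral_comp_smul (volume : Measure (Fin d → ℝ))
    (fun p => chr p x * ∫ y, chr (-p) y * h y) (2 * π)
  have hpi : ((((2 * π) ^ d : ℝ)) : ℂ) ≠ 0 := by
    rw [ofReal_ne_zero]
    positivity
  rw [Module.finrank_fin_fun, abs_of_pos (by positivity), real_smul, ofReal_inv,
    eq_inv_mul_iff_mul_eq₀ hpi] at hs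
  rw [← hs]
  congr 2
  funext p
  congr 1
  · rw [chr, dotR_smul_left, dotR_comm p x, mul_comm I]
  · congr 1
    funext y
    rw [chr, dotR_neg_left, dotR_smul_left, mul_comm I, neg_mul, neg_mul]

lemma exists_norm_sip_rho_le (a Φ : Sch d) (n : ℕ) :
    ∃ C, 0 ≤ C ∧ ∀ z, ‖sip (rho z a) Φ‖ ≤ C * ((1 + ‖z‖) ^ n)⁻¹ := by
  obtain ⟨C, hC0, hC⟩ := beals_sip.decay n a Φ
  refine ⟨C, hC0, fun z => ?_⟩
  rw [← div_eq_mul_inv, le_div_iff₀ (by positivity), mul_comm]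
  simpa [rho_zero] using hC z 0

lemma continuous_sip_rho (a Φ : Sch d) : Continuous fun z => sip (rho z a) Φ := by
  simpa only [Function.comp_def, rho_zero] using
    (beals_sip.continuous a Φ).comp (Continuous.prodMk_left (0 : Phase d))

lemma integrable_sip_rho (a Φ : Sch d) : Integrable fun z => sip (rho z a) Φ := by
  obtain ⟨C, hC0, hC⟩ := exists_norm_sip_rho_le a Φ (2 * d + 1)
  exact (integrable_phase_weight.const_mul C).mono' (continuous_sip_rho a Φ).aestronglyMeasurable
    (Filter.Eventually.of_forall hC)

lemma exists_norm_le (b : Sch d) : ∃ C, 0 ≤ C ∧ ∀ x, ‖b x‖ ≤ C := by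
  obtain ⟨C, hC0, hC⟩ := exists_decay b 0
  exact ⟨C, hC0, by simpa using hC⟩

/-- The pointwise form of the resolution of the identity. -/
lemma integral_sip_mul_rho_apply (a b Φ : Sch d) (x : Fin d → ℝ) :
    ∫ z, sip (rho z a) Φ * rho z b x = ((2 * π : ℝ) ^ d : ℝ) * sip a b * Φ x := by
  obtain ⟨C, hC0, hC⟩ := exists_norm_le b
  have hi : Integrable fun z => sip (rho z a) Φ * rho z b x := by
    refine (integrable_sip_rho a Φ).mul_bdd (c := C) ?_ (Filter.Eventually.of_forall fun z => ?_)
    · simp only [rho_apply]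
      exact Continuous.aestronglyMeasurable (by fun_prop)
    · rw [rho_apply, norm_mul, norm_chr, one_mul]
      exact hC _
  rw [Measure.volume_eq_prod] at hi ⊢
  rw [integral_prod _ hi]
  have inner_eq : ∀ q : Fin d → ℝ, ∫ p, sip (rho (q, p) a) Φ * rho (q, p) b x
      = ((2 * π : ℝ) ^ d : ℝ) * Φ x * ((starRingEnd ℂ) (a (x - q)) * b (x - q)) := by
    intro q
    let h : Sch d := SchwartzMap.pairing (ContinuousLinearMap.mul ℂ ℂ) (conjS (rho (q, 0) a)) Φ
    have hh : ∀ y, h y = (starRingEnd ℂ) (a (y - q)) * Φ y := by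
      intro y
      simp [h, SchwartzMap.pairing_apply_apply, conjS_apply, rho_apply, chr, dotR_zero_left]
    have e : ∀ p, sip (rho (q, p) a) Φ * rho (q, p) b x
        = b (x - q) * (chr p x * ∫ y, chr (-p) y * h y) := by
      intro p
      rw [sip_apply, rho_apply]
      simp only [rho_apply, hh, map_mul, conj_chr, mul_assoc]
      ring
    simp only [e]
    rw [integral_const_mul, integral_chr_mul_integral, hh]
    ring
  simp only [inner_eq]
  rw [integral_const_mul,
    integral_sub_left_eq_self (fun y => (starRingEnd ℂ) (a y) * b y) volume x, ← sip_apply]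
  ring

lemma integral_sip_mul_sip_rho (a b Φ Ψ : Sch d) :
    ∫ z, sip (rho z a) Φ * sip Ψ (rho z b) = ((2 * π : ℝ) ^ d : ℝ) * sip a b * sip Ψ Φ := by
  obtain ⟨C, hC0, hC⟩ := exists_norm_le b
  have hi : Integrable (fun zx : Phase d × (Fin d → ℝ) =>
      sip (rho zx.1 a) Φ * ((starRingEnd ℂ) (Ψ zx.2) * rho zx.1 b zx.2))
      (volume.prod volume) := by
    have h1 := (integrable_sip_rho a Φ).mul_prod ((conjS Ψ).integrable (μ := volume))
    simp only [conjS_apply] at h1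
    simp only [← mul_assoc]
    refine h1.mul_bdd (c := C) ?_ (Filter.Eventually.of_forall fun z => ?_)
    · simp only [rho_apply]
      exact Continuous.aestronglyMeasurable (by fun_prop)
    · rw [rho_apply, norm_mul, norm_chr, one_mul]
      exact hC _
  have h1 : ∀ z, sip (rho z a) Φ * sip Ψ (rho z b)
      = ∫ x, sip (rho z a) Φ * ((starRingEnd ℂ) (Ψ x) * rho z b x) := fun z => by
    rw [integral_const_mul, ← sip_apply]
  simp only [h1]
  rw [integral_integral_swap hi]
  have h2 : ∀ x, ∫ z, sip (rho z a) Φ * ((starRingEnd ℂ) (Ψ x) * rho z b x)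
      = ((2 * π : ℝ) ^ d : ℝ) * sip a b * ((starRingEnd ℂ) (Ψ x) * Φ x) := fun x => by
    simp only [mul_left_comm _ ((starRingEnd ℂ) (Ψ x))]
    rw [integral_const_mul, integral_sip_mul_rho_apply]
  simp only [h2]
  rw [integral_const_mul, ← sip_apply]

lemma continuous_toLp_rho (b : Sch d) :
    Continuous fun z => SchwartzMap.toLpCLM ℂ ℂ 2 (volume : Measure (Fin d → ℝ)) (rho z b) := by
  rw [continuous_iff_continuousAt]
  intro z₀
  rw [ContinuousAt, tendsto_iff_norm_sub_tendsto_zero]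
  simpa only [nm, map_sub] using tendsto_nm_rho_sub b z₀

/-- The resolution of the identity, tested against an `L²`-bounded functional. -/
theorem integral_sip_mul_map_rho (a b Φ : Sch d) (ℓ : Sch d →ₗ[ℂ] ℂ) {C : ℝ}
    (hℓ : ∀ φ, ‖ℓ φ‖ ≤ C * nm φ) :
    ∫ z, sip (rho z a) Φ * ℓ (rho z b) = ((2 * π : ℝ) ^ d : ℝ) * sip a b * ℓ Φ := by
  let e := SchwartzMap.toLpCLM ℂ ℂ 2 (volume : Measure (Fin d → ℝ))
  have hd : DenseRange e := SchwartzMap.denseRange_toLpCLM (by simp)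
  have hL := LinearMap.extendOfNorm_eq (f := ℓ) (e := e.toLinearMap) hd ⟨C, hℓ⟩
  generalize ℓ.extendOfNorm e.toLinearMap = L at hL
  have hL' : ∀ φ, ℓ φ = L (e φ) := fun φ => (hL φ).symm
  have hi : Integrable fun z => sip (rho z a) Φ • e (rho z b) := by
    refine (integrable_sip_rho a Φ).smul_bdd (nm b)
      (continuous_toLp_rho b).aestronglyMeasurable (Filter.Eventually.of_forall fun z => ?_)
    exact (nm_rho z b).le
  have h1 : ∫ z, sip (rho z a) Φ • e (rho z b) = (((2 * π : ℝ) ^ d : ℝ) * sip a b) • e Φ := by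
    refine hd.eq_of_inner_right ℂ fun Ψ => ?_
    rw [← integral_inner hi, inner_smul_right]
    simp only [inner_smul_right]
    exact integral_sip_mul_sip_rho a b Φ Ψ
  have h2 := L.integral_comp_comm hi
  rw [h1, map_smul] at h2
  simpa only [hL', map_smul, smul_eq_mul] using h2

lemma weight_mul_weight_le {E : Type*} [NormedAddCommGroup E] (x y : E) (n : ℕ) :
    ((1 + ‖x‖) ^ n)⁻¹ * ((1 + ‖y‖) ^ n)⁻¹ ≤ ((1 + ‖x + y‖) ^ n)⁻¹ := by
  rw [← mul_inv, ← mul_pow]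
  gcongr
  nlinarith [norm_add_le x y, norm_nonneg x, norm_nonneg y]

lemma weight_two_smul_le {E : Type*} [NormedAddCommGroup E] [NormedSpace ℝ E] (x : E) (n : ℕ) :
    ((1 + ‖(2 : ℝ) • x‖) ^ n)⁻¹ ≤ ((1 + ‖x‖) ^ n)⁻¹ := by
  gcongr
  rw [norm_smul, Real.norm_ofNat]
  linarith [norm_nonneg x]

/-- The Wigner-type transform of a pair of Schwartz functions. -/
def wig (Ψ Φ : Sch d) (u : Phase d) : ℂ :=
  chr u.2 u.1 ^ 2 * sip (rho ((2 : ℝ) • u) (par Ψ)) Φ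

lemma continuous_wig (Ψ Φ : Sch d) : Continuous (wig Ψ Φ) := by
  unfold wig
  exact Continuous.mul (by fun_prop)
    ((continuous_sip_rho (par Ψ) Φ).comp (continuous_const_smul (2 : ℝ)))

lemma exists_norm_wig_le (Ψ Φ : Sch d) (n : ℕ) :
    ∃ C, 0 ≤ C ∧ ∀ u, ‖wig Ψ Φ u‖ ≤ C * ((1 + ‖u‖) ^ n)⁻¹ := by
  obtain ⟨C, hC0, hC⟩ := exists_norm_sip_rho_le (par Ψ) Φ n
  refine ⟨C, hC0, fun u => ?_⟩
  rw [wig, norm_mul, norm_pow, norm_chr, one_pow, one_mul]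
  exact (hC _).trans (mul_le_mul_of_nonneg_left (weight_two_smul_le u n) hC0)

lemma integrable_wig (Ψ Φ : Sch d) : Integrable (wig Ψ Φ) := by
  obtain ⟨C, hC0, hC⟩ := exists_norm_wig_le Ψ Φ (2 * d + 1)
  exact (integrable_phase_weight.const_mul C).mono' (continuous_wig Ψ Φ).aestronglyMeasurable
    (Filter.Eventually.of_forall hC)

lemma exists_norm_le_weight (a : Sch d) (n : ℕ) :
    ∃ C, 0 ≤ C ∧ ∀ x, ‖a x‖ ≤ C * ((1 + ‖x‖) ^ n)⁻¹ := by
  obtain ⟨C, hC0, hC⟩ := exists_decay a n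
  refine ⟨C, hC0, fun x => ?_⟩
  rw [← div_eq_mul_inv, le_div_iff₀ (by positivity), mul_comm]
  exact hC x

/-- The Weyl pairing at fixed momentum, in terms of the Wigner-type transform. -/
lemma integral_integral_weyl (Ψ Φ : Sch d) {a : Phase d → ℂ} (ha : Continuous a) {A : ℝ}
    (hA : ∀ u, ‖a u‖ ≤ A) (ξ : Fin d → ℝ) :
    ∫ x : Fin d → ℝ, ∫ x' : Fin d → ℝ, cexp (I * (dotR ξ (x - x') : ℝ)) *
      (starRingEnd ℂ) (Ψ x) * a ((2 : ℝ)⁻¹ • (x + x'), ξ) * Φ x'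
    = (2 : ℂ) ^ d * ∫ m, a (m, ξ) * wig Ψ Φ (m, ξ) := by
  let G : (Fin d → ℝ) → (Fin d → ℝ) → ℂ := fun x x' => chr ξ (x - x') *
      (starRingEnd ℂ) (Ψ x) * a ((2 : ℝ)⁻¹ • (x + x'), ξ) * Φ x'
  have hG : Continuous fun z : (Fin d → ℝ) × (Fin d → ℝ) => G z.1 z.2 := by
    have := Complex.continuous_conj
    have := Ψ.continuous
    have := Φ.continuous
    fun_prop
  have h1 : ∀ x, ∫ x', G x x' = (2 : ℂ) ^ d * ∫ m, G x ((2 : ℝ) • m - x) := by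
    intro x
    have := Measure.integral_comp_smul (volume : Measure (Fin d → ℝ)) (fun y => G x (y - x)) 2
    rw [this, integral_sub_right_eq_self (G x) x, Module.finrank_fin_fun,
      abs_of_pos (by positivity), real_smul, ← mul_assoc]
    push_cast
    rw [mul_inv_cancel₀ (pow_ne_zero d two_ne_zero), one_mul]
  have hi : Integrable (fun z : (Fin d → ℝ) × (Fin d → ℝ) => G z.1 ((2 : ℝ) • z.2 - z.1))
      (volume.prod volume) := by
    obtain ⟨C, hC0, hC⟩ := exists_norm_le_weight Ψ ((d + 1) * 2)
    obtain ⟨D, hD0, hD⟩ := exists_norm_le_weight Φ (d + 1)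
    have hA0 : 0 ≤ A := (norm_nonneg _).trans (hA 0)
    have hw : Integrable (fun x : Fin d → ℝ => ((1 + ‖x‖) ^ (d + 1))⁻¹) :=
      integrable_weight volume (by simp)
    refine ((hw.mul_prod hw).const_mul (C * A * D)).mono'
      (hG.comp (f := fun z : (Fin d → ℝ) × (Fin d → ℝ) => (z.1, (2 : ℝ) • z.2 - z.1))
        (by fun_prop)).aestronglyMeasurable
      (Filter.Eventually.of_forall fun z => ?_)
    simp only [G, norm_mul, norm_chr, one_mul, RCLike.norm_conj]
    have h2 := weight_mul_weight_le z.1 ((2 : ℝ) • z.2 - z.1) (d + 1)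
    rw [add_sub_cancel] at h2
    have h3 := h2.trans (weight_two_smul_le z.2 (d + 1))
    calc _ ≤ (C * ((1 + ‖z.1‖) ^ ((d + 1) * 2))⁻¹) * A
          * (D * ((1 + ‖(2 : ℝ) • z.2 - z.1‖) ^ (d + 1))⁻¹) := by
          gcongr
          · exact hC _
          · exact hA _
          · exact hD _
      _ = C * A * D * ((1 + ‖z.1‖) ^ (d + 1))⁻¹ * (((1 + ‖z.1‖) ^ (d + 1))⁻¹ *
          ((1 + ‖(2 : ℝ) • z.2 - z.1‖) ^ (d + 1))⁻¹) := by rw [pow_mul, sq, mul_inv]; ring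
      _ ≤ C * A * D * ((1 + ‖z.1‖) ^ (d + 1))⁻¹ * ((1 + ‖z.2‖) ^ (d + 1))⁻¹ := by gcongr
      _ = _ := by ring
  calc _ = ∫ x, ∫ x', G x x' := rfl
    _ = (2 : ℂ) ^ d * ∫ x, ∫ m, G x ((2 : ℝ) • m - x) := by
        simp only [h1]
        rw [integral_const_mul]
    _ = (2 : ℂ) ^ d * ∫ m, ∫ x, G x ((2 : ℝ) • m - x) := by rw [integral_integral_swap hi]
    _ = _ := by
        congr 2
        funext m
        rw [← integral_sub_left_eq_self _ volume ((2 : ℝ) • m), wig, sip_apply,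
          ← integral_const_mul, ← integral_const_mul]
        congr 1
        funext y
        have e1 : (2 : ℝ)⁻¹ • ((2 : ℝ) • m - y + ((2 : ℝ) • m - ((2 : ℝ) • m - y))) = m := by
          rw [sub_sub_cancel, sub_add_cancel, smul_smul]
          norm_num
        have e2 : chr ξ ((2 : ℝ) • m - y - ((2 : ℝ) • m - ((2 : ℝ) • m - y)))
            = chr ξ m ^ 2 * (starRingEnd ℂ) (chr ((2 : ℝ) • ξ) y) := by
          rw [conj_chr, ← neg_smul, sub_sub_cancel, two_smul, show m + m - y - y
            = m + m + (-y + -y) by abel, chr_add_right, chr_add_right, chr_add_right, neg_smul,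
            two_smul, neg_add, chr_add_left, chr_neg_left, sq]
        simp only [G]
        rw [e1, e2, sub_sub_cancel, rho_apply, par_apply, map_mul, Prod.smul_snd, Prod.smul_fst,
          neg_sub]
        ring

lemma sip_par_par (a b : Sch d) : sip (par a) (par b) = sip a b := by
  simp only [sip_apply, par_apply]
  exact integral_neg_eq_self (fun x => (starRingEnd ℂ) (a x) * b x) volume

lemma integral_comp_two_smul_phase (F : Phase d → ℂ) :
    ∫ u, F ((2 : ℝ) • u) = ((2 : ℂ) ^ (2 * d))⁻¹ * ∫ u, F u := by
  rw [Measure.integral_comp_smul, finrank_phase, abs_of_pos (by positivity), real_smul]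
  push_cast
  rfl

lemma symK_mul_wig (g Ψ Φ : Sch d) (B : Form d) (u z : Phase d) :
    symK g B u (z - u) * wig Ψ Φ u = sip (rho ((2 : ℝ) • u) (par Ψ)) Φ *
      B (rho z g) (rho ((2 : ℝ) • u) (par (rho z g))) := by
  rw [symK_eq, wig, par_rho, rho_rho, add_sub_cancel, sub_sub_eq_add_sub, ← two_smul ℝ u,
    ← sub_eq_add_neg, map_smul, smul_eq_mul, Prod.snd_neg, neg_neg, Prod.smul_fst, two_smul ℝ u.1,
    chr_add_right]
  have : chr z.2 u.1 = chr (z - u).2 u.1 * chr u.2 u.1 := by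
    rw [← chr_add_left, Prod.snd_sub, sub_add_cancel]
  rw [this]
  ring

/-- The resolution of the identity, tested against a form in its first argument. -/
lemma Beals.integral_sip_mul_apply_rho {B : Form d} (hB : Beals B) (g Ψ Φ : Sch d) :
    ∫ z, sip Ψ (rho z g) * B (rho z g) Φ = ((2 * π : ℝ) ^ d : ℝ) * (nm g : ℂ) ^ 2 * B Ψ Φ := by
  obtain ⟨C, hC0, hC⟩ := hB.bound
  let ℓ : Sch d →ₗ[ℂ] ℂ :=
    { toFun := fun φ => (starRingEnd ℂ) (B φ Φ)
      map_add' := fun φ φ' => by simp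
      map_smul' := fun c φ => by simp }
  have h := integral_sip_mul_map_rho g g Ψ ℓ (C := C * nm Φ) fun φ => by
    simpa [ℓ, mul_right_comm] using hC φ Φ
  have h2 := congrArg (starRingEnd ℂ) h
  rw [← integral_conj] at h2
  simp only [map_mul, conj_sip, conj_ofReal, sip_self] at h2
  simpa [ℓ] using h2

theorem Beals.integral_sym_mul_wig {B : Form d} (hB : Beals B) (g Ψ Φ : Sch d) :
    ∫ u, sym g B u * wig Ψ Φ u = ((2 : ℂ) ^ (2 * d))⁻¹ * (((2 * π : ℝ) ^ d : ℝ) *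
      (((2 * π : ℝ) ^ d : ℝ) * (nm g : ℂ) ^ 2 * B Ψ Φ)) := by
  obtain ⟨C, hC0, hC⟩ := hB.norm_symK_le g (2 * d + 1)
  obtain ⟨D, hD0, hD⟩ := exists_norm_wig_le Ψ Φ ((2 * d + 1) * 2)
  obtain ⟨E, hE0, hE⟩ := hB.bound
  have hi : Integrable (fun uz : Phase d × Phase d =>
      symK g B uz.1 (uz.2 - uz.1) * wig Ψ Φ uz.1) (volume.prod volume) := by
    refine ((integrable_phase_weight.mul_prod integrable_phase_weight).const_mul (C * D)).mono'
      (Continuous.aestronglyMeasurable ?_) (Filter.Eventually.of_forall fun z => ?_)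
    · exact ((hB.continuous_symK g).comp (f := fun uz : Phase d × Phase d =>
        (uz.1, uz.2 - uz.1)) (by fun_prop)).mul ((continuous_wig Ψ Φ).comp continuous_fst)
    · have h2 := weight_mul_weight_le z.1 (z.2 - z.1) (2 * d + 1)
      rw [add_sub_cancel] at h2
      rw [norm_mul]
      calc _ ≤ (C * ((1 + ‖z.2 - z.1‖) ^ (2 * d + 1))⁻¹)
            * (D * ((1 + ‖z.1‖) ^ ((2 * d + 1) * 2))⁻¹) := by
            gcongr
            · exact hC _ _
            · exact hD _
        _ = C * D * ((1 + ‖z.1‖) ^ (2 * d + 1))⁻¹ * (((1 + ‖z.1‖) ^ (2 * d + 1))⁻¹ *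
            ((1 + ‖z.2 - z.1‖) ^ (2 * d + 1))⁻¹) := by rw [pow_mul, sq, mul_inv]; ring
        _ ≤ C * D * ((1 + ‖z.1‖) ^ (2 * d + 1))⁻¹ * ((1 + ‖z.2‖) ^ (2 * d + 1))⁻¹ := by gcongr
        _ = _ := by ring
  have h1 : ∀ u, sym g B u * wig Ψ Φ u = ∫ z, symK g B u (z - u) * wig Ψ Φ u := fun u => by
    rw [integral_mul_const, integral_sub_right_eq_self (symK g B u) u, sym]
  have h2 : ∀ z, ∫ u, symK g B u (z - u) * wig Ψ Φ u
      = ((2 : ℂ) ^ (2 * d))⁻¹ * (((2 * π : ℝ) ^ d : ℝ) * (sip Ψ (rho z g) * B (rho z g) Φ)) := by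
    intro z
    simp only [symK_mul_wig]
    rw [integral_comp_two_smul_phase (fun w => sip (rho w (par Ψ)) Φ *
      B (rho z g) (rho w (par (rho z g)))), integral_sip_mul_map_rho _ _ _ _ (hE (rho z g)),
      sip_par_par, mul_assoc]
  simp only [h1]
  rw [integral_integral_swap hi]
  simp only [h2]
  rw [integral_const_mul, integral_const_mul, hB.integral_sip_mul_apply_rho]

lemma exists_window (d : ℕ) : ∃ g : Sch d, nm g ≠ 0 := by
  let b : ContDiffBump (0 : Fin d → ℝ) := default
  have hc : HasCompactSupport fun x => (b x : ℂ) := b.hasCompactSupport.comp_left (g := fun t : ℝ => (t : ℂ)) (by simp)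
  have hs : ContDiff ℝ (⊤ : ℕ∞) fun x => (b x : ℂ) := Complex.ofRealCLM.contDiff.comp b.contDiff
  let g : Sch d := hc.toSchwartzMap hs
  refine ⟨g, fun h => ?_⟩
  have h0 : g = 0 := by
    have hinj := SchwartzMap.injective_toLp (F := ℂ) (E := Fin d → ℝ) 2 volume
    have h1 : SchwartzMap.toLpCLM ℂ ℂ 2 volume g = SchwartzMap.toLpCLM ℂ ℂ 2 volume 0 := by
      rw [map_zero]
      exact norm_eq_zero.1 h
    exact hinj h1
  have : g 0 = 1 := by
    have : g 0 = (b 0 : ℂ) := rfl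
    rw [this, b.one_of_mem_closedBall (Metric.mem_closedBall_self b.rIn_pos.le)]
    simp
  rw [h0] at this
  simp at this

/-- Beals' criterion for sesquilinear forms on Schwartz space. -/
theorem Beals.exists_weyl_symbol {B : Form d} (hB : Beals B) :
    ∃ a : Phase d → ℂ, ContDiff ℝ (⊤ : ℕ∞) a
      ∧ (∀ n : ℕ, ∃ C, ∀ z, ‖iteratedFDeriv ℝ n a z‖ ≤ C)
      ∧ ∀ Ψ Φ : Sch d, B Ψ Φ = (((2 * π : ℝ) ^ d)⁻¹ : ℝ) *
          ∫ ξ : Fin d → ℝ, ∫ x : Fin d → ℝ, ∫ x' : Fin d → ℝ,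
            cexp (I * (dotR ξ (x - x') : ℝ)) *
              (starRingEnd ℂ) (Ψ x) * a ((2 : ℝ)⁻¹ • (x + x'), ξ) * Φ x' := by
  obtain ⟨g, hg⟩ := exists_window d
  let c : ℂ := (2 : ℂ) ^ d * ((((2 * π : ℝ) ^ d : ℝ) : ℂ) * (nm g : ℂ) ^ 2)⁻¹
  have hsm : ContDiff ℝ (⊤ : ℕ∞) (sym g B) := contDiff_infty.2 fun n => Beals.contDiff_sym g n hB
  have hbd : ∀ n : ℕ, ∃ C, ∀ z, ‖iteratedFDeriv ℝ n (fun u => c • sym g B u) z‖ ≤ C := fun n => by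
    obtain ⟨C, hC⟩ := Beals.norm_iteratedFDeriv_sym_le g n hB
    refine ⟨‖c‖ * C, fun z => ?_⟩
    rw [iteratedFDeriv_const_smul_apply' ((hsm.of_le (by exact_mod_cast le_top)).contDiffAt),
      norm_smul]
    exact mul_le_mul_of_nonneg_left (hC z) (norm_nonneg c)
  refine ⟨fun u => c • sym g B u, hsm.const_smul c, hbd, fun Ψ Φ => ?_⟩
  obtain ⟨A, hA⟩ := hbd 0
  simp only [norm_iteratedFDeriv_zero] at hA
  have hcont : Continuous fun u => c • sym g B u := (hsm.const_smul c).continuous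
  have hi : Integrable (fun u => c • sym g B u * wig Ψ Φ u) (volume.prod volume) :=
    (integrable_wig Ψ Φ).bdd_mul hcont.aestronglyMeasurable (Filter.Eventually.of_forall hA)
  simp only [integral_integral_weyl Ψ Φ hcont hA]
  rw [integral_const_mul, ← integral_prod_symm _ hi]
  simp only [smul_mul_assoc]
  rw [integral_smul, ← Measure.volume_eq_prod, hB.integral_sym_mul_wig, smul_eq_mul]
  have h2 : (((2 * π : ℝ) ^ d : ℝ) : ℂ) ≠ 0 := by
    rw [ofReal_ne_zero]
    positivity
  have h3 : (nm g : ℂ) ≠ 0 := by exact_mod_cast hg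
  simp only [c]
  rw [ofReal_inv, mul_comm 2 d, pow_mul]
  field_simp

/-- The form on Schwartz space induced by a sesquilinear form on functions. -/
def formOf (Q : ((Fin d → ℝ) → ℂ) → ((Fin d → ℝ) → ℂ) → ℂ)
    (hadd₁ : ∀ f f' h, Q (f + f') h = Q f h + Q f' h)
    (hsmul₁ : ∀ (c : ℂ) f h, Q (c • f) h = (starRingEnd ℂ) c * Q f h)
    (hadd₂ : ∀ f h h', Q f (h + h') = Q f h + Q f h')
    (hsmul₂ : ∀ (c : ℂ) f h, Q f (c • h) = c * Q f h) : Form d :=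
  LinearMap.mk₂'ₛₗ (starRingEnd ℂ) (RingHom.id ℂ) (fun a b => Q ⇑a ⇑b)
    (fun _ _ _ => hadd₁ _ _ _) (fun _ _ _ => hsmul₁ _ _ _)
    (fun _ _ _ => hadd₂ _ _ _) (fun _ _ _ => hsmul₂ _ _ _)

lemma commList_eq_foldr_comm {Q : ((Fin d → ℝ) → ℂ) → ((Fin d → ℝ) → ℂ) → ℂ} {B : Form d}
    (hQ : ∀ a b : Sch d, Q a b = B a b) (l : List (Fin d ⊕ Fin d)) (a b : Sch d) :
    commList (l.map Wop) Q a b = l.foldr comm B a b := by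
  induction l generalizing a b with
  | nil => exact hQ a b
  | cons k l ih =>
    rw [List.foldr_cons, comm_apply, ← ih, ← ih, coe_wop, coe_wop]
    rfl

end WeylBeals

/-- Beals criterion: if the sesquilinear form `Q(Ψ,Φ) = ⟨Ψ, TΦ⟩` of a
continuous map `T : 𝒮(ℝ^d) → 𝒮'(ℝ^d)` and of all its iterated commutators with the
operators `W_k` extend boundedly to `L²(ℝ^d)`, then `T` is the Weyl quantization of a
symbol `a₀ ∈ S⁰_{0,0}(ℝ^{2d})`. -/
theorem stmt15 {d : ℕ} (Q : ((Fin d → ℝ) → ℂ) → ((Fin d → ℝ) → ℂ) → ℂ)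
    (hadd₁ : ∀ f f' h, Q (f + f') h = Q f h + Q f' h)
    (hsmul₁ : ∀ (c : ℂ) f h, Q (c • f) h = (starRingEnd ℂ) c * Q f h)
    (hadd₂ : ∀ f h h', Q f (h + h') = Q f h + Q f h')
    (hsmul₂ : ∀ (c : ℂ) f h, Q f (c • h) = c * Q f h)
    (hcont : ∀ Ψ : SchwartzMap (Fin d → ℝ) ℂ,
      Continuous fun Φ : SchwartzMap (Fin d → ℝ) ℂ => Q (fun x => Ψ x) (fun x => Φ x))
    (hcomm : ∀ l : List (Fin d ⊕ Fin d), ∃ C,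
      ∀ Ψ Φ : SchwartzMap (Fin d → ℝ) ℂ,
        ‖commList (l.map Wop) Q (fun x => Ψ x) (fun x => Φ x)‖ ≤
          C * l2norm (fun x => Ψ x) * l2norm (fun x => Φ x)) :
    ∃ a₀ : (Fin d → ℝ) × (Fin d → ℝ) → ℂ, ContDiff ℝ (⊤ : ℕ∞) a₀
      ∧ (∀ n : ℕ, ∃ C, ∀ z, ‖iteratedFDeriv ℝ n a₀ z‖ ≤ C)
      ∧ ∀ Ψ Φ : SchwartzMap (Fin d → ℝ) ℂ,
          Q (fun x => Ψ x) (fun x => Φ x) =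
            (((2 * π : ℝ) ^ d)⁻¹ : ℝ) *
              ∫ ξ : Fin d → ℝ, ∫ x : Fin d → ℝ, ∫ x' : Fin d → ℝ,
                Complex.exp (Complex.I * (dotR ξ (x - x') : ℝ)) *
                  (starRingEnd ℂ) (Ψ x) * a₀ ((2 : ℝ)⁻¹ • (x + x'), ξ) * Φ x' := by
  have hQ : ∀ a b : WeylBeals.Sch d,
      Q a b = WeylBeals.formOf Q hadd₁ hsmul₁ hadd₂ hsmul₂ a b := fun _ _ => rfl
  have hB : WeylBeals.Beals (WeylBeals.formOf Q hadd₁ hsmul₁ hadd₂ hsmul₂) := fun l => by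
    obtain ⟨C, hC⟩ := hcomm l
    refine ⟨C, fun a b => ?_⟩
    rw [← WeylBeals.commList_eq_foldr_comm hQ, WeylBeals.nm_eq_l2norm, WeylBeals.nm_eq_l2norm]
    exact hC a b
  exact hB.exists_weyl_symbol
end
end
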